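/- arXiv:0912.0359 — 2 statements merged into one kernel-verified Lean document; each statement's English description precedes it below -/
import Mathlib

section
/- There exists a constant c ≥ 1 with the following property. Whenever r, q satisfy conditions (1.2) and (1.3), u, v is a principal fundamental system of solutions of (r z')' = q z, and h(x) d(x) → 0 as |x| → ∞, the Green operator G : L₂(ℝ) → L₂(ℝ) is compact, self-adjoint, and positive (i.e. ⟨G f, f⟩ ≥ 0 for every f ∈ L₂(ℝ)), and its maximal eigenvalue λ satisfies c⁻¹ B ≤ λ ≤ c B, where B = sup_{x∈ℝ} h(x) d(x). -/
open MeasureTheory Filter Topology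
open scoped ENNReal RealInnerProductSpace

noncomputable section

/-- Conditions (1.2): `r, q` measurable, `r > 0`, `q ≥ 0`, with `1/r` and `q`
locally Lebesgue integrable on `ℝ`. -/
def Cond12 (r q : ℝ → ℝ) : Prop :=
  Measurable r ∧ Measurable q ∧ (∀ x, 0 < r x) ∧ (∀ x, 0 ≤ q x) ∧
    LocallyIntegrable (fun t => 1 / r t) volume ∧ LocallyIntegrable q volume

/-- Condition (1.3): for every `x`,
`(∫_{x-d}^x dt/r(t)) · (∫_{x-d}^x q(t) dt) → ∞` as `|d| → ∞`. -/
def Cond13 (r q : ℝ → ℝ) : Prop :=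
  ∀ x : ℝ, Tendsto (fun d : ℝ => (∫ t in x - d..x, 1 / r t) * (∫ t in x - d..x, q t))
    (cocompact ℝ) atTop

/-- Condition (2.1): `∫_{-∞}^x q > 0` and `∫_x^∞ q > 0` for every `x`. -/
def Cond21 (q : ℝ → ℝ) : Prop :=
  ∀ x : ℝ, 0 < ∫⁻ t in Set.Iic x, ENNReal.ofReal (q t) ∧
    0 < ∫⁻ t in Set.Ici x, ENNReal.ofReal (q t)

/-- A principal fundamental system of solutions `u, v` (with a.e. derivatives
`u', v'`) of the equation `(r z')' = q z`:  `u, v, r u', r v'` are locally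
absolutely continuous (expressed through the integral identities below),
`(r u')' = q u` and `(r v')' = q v` a.e., `u > 0`, `v > 0`, `v' ≥ 0`, `u' ≤ 0`,
`r (v' u - u' v) ≡ 1`, `v/u → 0` at `-∞`, `u/v → 0` at `+∞`,
`∫_{-∞}^0 dt/(r u²) < ∞` and `∫_0^∞ dt/(r v²) < ∞`. -/
structure PFSS (r q u v u' v' : ℝ → ℝ) : Prop where
  u_pos : ∀ x, 0 < u x
  v_pos : ∀ x, 0 < v x
  u'_nonpos : ∀ x, u' x ≤ 0
  v'_nonneg : ∀ x, 0 ≤ v' x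
  u'_intble : ∀ a b : ℝ, IntervalIntegrable u' volume a b
  v'_intble : ∀ a b : ℝ, IntervalIntegrable v' volume a b
  u_deriv : ∀ a b : ℝ, u b - u a = ∫ t in a..b, u' t
  v_deriv : ∀ a b : ℝ, v b - v a = ∫ t in a..b, v' t
  ru'_deriv : ∀ a b : ℝ, r b * u' b - r a * u' a = ∫ t in a..b, q t * u t
  rv'_deriv : ∀ a b : ℝ, r b * v' b - r a * v' a = ∫ t in a..b, q t * v t
  wronskian : ∀ x, r x * (v' x * u x - u' x * v x) = 1
  ratio_bot : Tendsto (fun x => v x / u x) atBot (𝓝 0)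
  ratio_top : Tendsto (fun x => u x / v x) atTop (𝓝 0)
  int_u : ∫⁻ t in Set.Iic (0:ℝ), ENNReal.ofReal (1 / (r t * u t ^ 2)) < ⊤
  int_v : ∫⁻ t in Set.Ici (0:ℝ), ENNReal.ofReal (1 / (r t * v t ^ 2)) < ⊤

/-- The Green kernel `G(x,t) = u(x) v(t)` for `x ≥ t`, `u(t) v(x)` for `x ≤ t`. -/
def greenKernel (u v : ℝ → ℝ) (x t : ℝ) : ℝ :=
  if t ≤ x then u x * v t else u t * v x

/-- The space `L_p(ℝ)` (with respect to Lebesgue measure). -/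
abbrev LpR (p : ℝ≥0∞) : Type := Lp ℝ p (volume : Measure ℝ)

/-- `G` is (a bounded realization on `L_p` of) the Green operator
`(G f)(x) = ∫_ℝ G(x,t) f(t) dt`. -/
def IsGreenOp (u v : ℝ → ℝ) (p : ℝ≥0∞) [Fact (1 ≤ p)]
    (G : LpR p →L[ℝ] LpR p) : Prop :=
  ∀ f : LpR p,
    (G f : ℝ → ℝ) =ᵐ[volume] fun x => ∫ t, greenKernel u v x t * (f : ℝ → ℝ) t

/-- `d₁` solves `(∫_{x-d}^x dt/r)(∫_{x-d}^x q dt) = 1`, `d₁ > 0`. -/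
def IsD1 (r q d₁ : ℝ → ℝ) : Prop :=
  ∀ x : ℝ, 0 < d₁ x ∧
    (∫ t in x - d₁ x..x, 1 / r t) * (∫ t in x - d₁ x..x, q t) = 1

/-- `d₂` solves `(∫_x^{x+d} dt/r)(∫_x^{x+d} q dt) = 1`, `d₂ > 0`. -/
def IsD2 (r q d₂ : ℝ → ℝ) : Prop :=
  ∀ x : ℝ, 0 < d₂ x ∧
    (∫ t in x..x + d₂ x, 1 / r t) * (∫ t in x..x + d₂ x, q t) = 1

/-- `φ(x) = ∫_{x-d₁(x)}^x dt/r(t)`. -/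
def phiF (r d₁ : ℝ → ℝ) (x : ℝ) : ℝ := ∫ t in x - d₁ x..x, 1 / r t

/-- `ψ(x) = ∫_x^{x+d₂(x)} dt/r(t)`. -/
def psiF (r d₂ : ℝ → ℝ) (x : ℝ) : ℝ := ∫ t in x..x + d₂ x, 1 / r t

/-- `h(x) = φ(x)ψ(x)/(φ(x)+ψ(x))`. -/
def hF (r d₁ d₂ : ℝ → ℝ) (x : ℝ) : ℝ :=
  phiF r d₁ x * psiF r d₂ x / (phiF r d₁ x + psiF r d₂ x)

/-- `d` solves `∫_{x-d(x)}^{x+d(x)} dt/(r(t)h(t)) = 1`, `d > 0`. -/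
def IsD (r h d : ℝ → ℝ) : Prop :=
  ∀ x : ℝ, 0 < d x ∧ (∫ t in x - d x..x + d x, 1 / (r t * h t)) = 1

/-- `s` solves `∫_{x-s(x)}^{x+s(x)} dt/(r(t)ρ(t)) = 1`, `s > 0`. -/
def IsS (r ρ s : ℝ → ℝ) : Prop :=
  ∀ x : ℝ, 0 < s x ∧ (∫ t in x - s x..x + s x, 1 / (r t * ρ t)) = 1



section SchurTest

variable {α : Type*} [MeasurableSpace α] {μ : Measure α}

theorem lintegral_enorm_sq_lt_top (f : Lp ℝ 2 μ) : ∫⁻ t, ‖f t‖ₑ ^ 2 ∂μ < ⊤ := by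
  have := lintegral_rpow_enorm_lt_top_of_eLpNorm_lt_top (p := 2) (by norm_num) (by norm_num)
    (Lp.memLp f).2
  simpa using this

/-- Schur's test for a symmetric nonnegative kernel, in terms of lower Lebesgue integrals. -/
theorem lintegral_sq_lintegral_kernel_le [SFinite μ] {k : α → α → ℝ≥0∞}
    (hk : Measurable (Function.uncurry k)) (hsymm : ∀ x t, k x t = k t x) {w : α → ℝ≥0∞}
    (hw : Measurable w) (hw0 : ∀ x, w x ≠ 0)
    (hwtop : ∀ x, w x ≠ ⊤) {C : ℝ≥0∞} (hC : ∀ x, ∫⁻ t, k x t * w t ∂μ ≤ C * w x)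
    {F : α → ℝ≥0∞} (hF : AEMeasurable F μ) :
    ∫⁻ x, (∫⁻ t, k x t * F t ∂μ) ^ 2 ∂μ ≤ C ^ 2 * ∫⁻ t, F t ^ 2 ∂μ := by
  have hkx (x : α) : Measurable (k x) := hk.of_uncurry_left
  have hpt (x : α) : (∫⁻ t, k x t * F t ∂μ) ^ 2 ≤
      ∫⁻ t, C * w x * (k x t * (F t ^ 2 / w t)) ∂μ := by
    have h1 : ∫⁻ t, k x t * F t ∂μ ≤ (∫⁻ t, k x t * w t ∂μ) ^ (1 / 2 : ℝ) *
        (∫⁻ t, k x t * (F t ^ 2 / w t) ∂μ) ^ (1 / 2 : ℝ) := by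
      refine le_trans (le_of_eq ?_) (ENNReal.lintegral_mul_norm_pow_le
        ((hkx x).mul hw).aemeasurable
        ((hkx x).aemeasurable.mul ((hF.pow_const 2).div hw.aemeasurable))
        (by norm_num) (by norm_num) (by norm_num))
      refine lintegral_congr fun t => ?_
      rw [← ENNReal.mul_rpow_of_nonneg _ _ (by norm_num)]
      have : k x t * w t * (k x t * (F t ^ 2 / w t)) = (k x t * F t) ^ (2 : ℝ) := by
        rw [ENNReal.rpow_two, mul_pow, div_eq_mul_inv]
        calc _ = k x t ^ 2 * F t ^ 2 * (w t * (w t)⁻¹) := by ring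
          _ = _ := by rw [ENNReal.mul_inv_cancel (hw0 t) (hwtop t), mul_one]
      simp only [Pi.mul_apply, Pi.div_apply]
      rw [this, ← ENNReal.rpow_mul]
      norm_num
    have hs (a : ℝ≥0∞) : (a ^ (1 / 2 : ℝ)) ^ 2 = a := by
      rw [← ENNReal.rpow_two, ← ENNReal.rpow_mul]; norm_num
    calc (∫⁻ t, k x t * F t ∂μ) ^ 2 ≤ _ := pow_le_pow_left' h1 2
      _ = (∫⁻ t, k x t * w t ∂μ) * ∫⁻ t, k x t * (F t ^ 2 / w t) ∂μ := by
        rw [mul_pow, hs, hs]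
      _ ≤ C * w x * ∫⁻ t, k x t * (F t ^ 2 / w t) ∂μ := by gcongr; exact hC x
      _ = _ := by
        rw [lintegral_const_mul'']
        exact (hkx x).aemeasurable.mul ((hF.pow_const 2).div hw.aemeasurable)
  have hmeas : AEMeasurable (Function.uncurry fun x t => C * w x * (k x t * (F t ^ 2 / w t)))
      (μ.prod μ) := by
    refine AEMeasurable.mul ((hw.comp measurable_fst).const_mul C).aemeasurable
      (hk.aemeasurable.mul (AEMeasurable.div (AEMeasurable.pow_const hF.comp_snd 2)
        (hw.comp measurable_snd).aemeasurable))
  calc ∫⁻ x, (∫⁻ t, k x t * F t ∂μ) ^ 2 ∂μ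
      ≤ ∫⁻ x, ∫⁻ t, C * w x * (k x t * (F t ^ 2 / w t)) ∂μ ∂μ := lintegral_mono hpt
    _ = ∫⁻ t, ∫⁻ x, C * w x * (k x t * (F t ^ 2 / w t)) ∂μ ∂μ := lintegral_lintegral_swap hmeas
    _ = ∫⁻ t, C * (F t ^ 2 / w t) * ∫⁻ x, k t x * w x ∂μ ∂μ := by
        refine lintegral_congr fun t => ?_
        rw [← lintegral_const_mul (f := fun x => k t x * w x) _ ((hkx t).mul hw)]
        refine lintegral_congr fun x => ?_
        rw [hsymm x t]; ring
    _ ≤ ∫⁻ t, C ^ 2 * F t ^ 2 ∂μ := by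
        refine lintegral_mono fun t => ?_
        calc C * (F t ^ 2 / w t) * ∫⁻ x, k t x * w x ∂μ
            ≤ C * (F t ^ 2 / w t) * (C * w t) := by gcongr; exact hC t
          _ = C ^ 2 * F t ^ 2 * (w t * (w t)⁻¹) := by rw [div_eq_mul_inv]; ring
          _ = C ^ 2 * F t ^ 2 := by
            rw [ENNReal.mul_inv_cancel (hw0 t) (hwtop t), mul_one]
    _ = C ^ 2 * ∫⁻ t, F t ^ 2 ∂μ := lintegral_const_mul'' _ (hF.pow_const 2)

/-- The hypotheses of Schur's test for a symmetric nonnegative kernel `K` with weight `w` and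
constant `C`. -/
structure SchurKernel (μ : Measure α) (K : α → α → ℝ) (w : α → ℝ) (C : ℝ) : Prop where
  measurable : Measurable (Function.uncurry K)
  symm : ∀ x t, K x t = K t x
  nonneg : ∀ x t, 0 ≤ K x t
  weight_measurable : Measurable w
  weight_pos : ∀ x, 0 < w x
  const_nonneg : 0 ≤ C
  bound : ∀ x, ∫⁻ t, ENNReal.ofReal (K x t * w t) ∂μ ≤ ENNReal.ofReal (C * w x)

namespace SchurKernel

variable {K : α → α → ℝ} {w : α → ℝ} {C : ℝ}

theorem aestronglyMeasurable_prod (hK : SchurKernel μ K w C) (f : Lp ℝ 2 μ) :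
    AEStronglyMeasurable (fun p : α × α => K p.1 p.2 * f p.2) (μ.prod μ) :=
  hK.measurable.aestronglyMeasurable.mul (Lp.aestronglyMeasurable f).comp_snd

variable [SFinite μ]

theorem lintegral_sq_le (hK : SchurKernel μ K w C) (f : Lp ℝ 2 μ) :
    ∫⁻ x, (∫⁻ t, ‖K x t * f t‖ₑ ∂μ) ^ 2 ∂μ ≤ ENNReal.ofReal C ^ 2 * ∫⁻ t, ‖f t‖ₑ ^ 2 ∂μ := by
  have h := lintegral_sq_lintegral_kernel_le (μ := μ) (k := fun x t => ENNReal.ofReal (K x t))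
    hK.measurable.ennreal_ofReal (fun x t => by rw [hK.symm])
    hK.weight_measurable.ennreal_ofReal (fun x => by simpa using hK.weight_pos x)
    (fun x => ENNReal.ofReal_ne_top) (C := ENNReal.ofReal C)
    (fun x => by
      have := hK.bound x
      rw [ENNReal.ofReal_mul hK.const_nonneg] at this
      simpa only [ENNReal.ofReal_mul (hK.nonneg _ _)] using this)
    (F := fun t => ‖f t‖ₑ) (Lp.aestronglyMeasurable f).enorm
  refine le_trans (le_of_eq ?_) h
  refine lintegral_congr fun x => ?_
  congr 1
  refine lintegral_congr fun t => ?_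
  rw [enorm_mul, Real.enorm_of_nonneg (hK.nonneg x t)]

theorem ae_integrable (hK : SchurKernel μ K w C) (f : Lp ℝ 2 μ) :
    ∀ᵐ x ∂μ, Integrable (fun t => K x t * f t) μ := by
  have hm : AEMeasurable (fun x => (∫⁻ t, ‖K x t * f t‖ₑ ∂μ) ^ 2) μ :=
    (hK.aestronglyMeasurable_prod f).enorm.lintegral_prod_right'.pow_const 2
  have hfin : ∫⁻ x, (∫⁻ t, ‖K x t * f t‖ₑ ∂μ) ^ 2 ∂μ ≠ ⊤ :=
    ((hK.lintegral_sq_le f).trans_lt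
      (ENNReal.mul_lt_top (by simp) (lintegral_enorm_sq_lt_top f))).ne
  filter_upwards [ae_lt_top' hm hfin] with x hx
  refine ⟨?_, ?_⟩
  · exact (hK.measurable.of_uncurry_left (x := x)).aestronglyMeasurable.mul
      (Lp.aestronglyMeasurable f)
  · rw [hasFiniteIntegral_iff_enorm]
    by_contra h
    rw [not_lt, top_le_iff] at h
    rw [h] at hx
    simp at hx

theorem memLp_integral (hK : SchurKernel μ K w C) (f : Lp ℝ 2 μ) :
    MemLp (fun x => ∫ t, K x t * f t ∂μ) 2 μ ∧
      eLpNorm (fun x => ∫ t, K x t * f t ∂μ) 2 μ ≤ ENNReal.ofReal C * eLpNorm f 2 μ := by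
  have hsm : AEStronglyMeasurable (fun x => ∫ t, K x t * f t ∂μ) μ :=
    (hK.aestronglyMeasurable_prod f).integral_prod_right'
  have hle : eLpNorm (fun x => ∫ t, K x t * f t ∂μ) 2 μ ≤ ENNReal.ofReal C * eLpNorm f 2 μ := by
    rw [eLpNorm_eq_lintegral_rpow_enorm_toReal (by norm_num) (by norm_num),
      eLpNorm_eq_lintegral_rpow_enorm_toReal (by norm_num) (by norm_num)]
    simp only [ENNReal.toReal_ofNat, ENNReal.rpow_ofNat]
    calc (∫⁻ x, ‖∫ t, K x t * f t ∂μ‖ₑ ^ 2 ∂μ) ^ (1 / 2 : ℝ)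
        ≤ (ENNReal.ofReal C ^ 2 * ∫⁻ t, ‖f t‖ₑ ^ 2 ∂μ) ^ (1 / 2 : ℝ) := by
          gcongr
          refine le_trans (lintegral_mono fun x => ?_) (hK.lintegral_sq_le f)
          gcongr
          exact enorm_integral_le_lintegral_enorm _
      _ = _ := by
          rw [ENNReal.mul_rpow_of_nonneg _ _ (by norm_num)]
          congr 1
          rw [← ENNReal.rpow_two, ← ENNReal.rpow_mul]
          norm_num
  exact ⟨⟨hsm, hle.trans_lt (ENNReal.mul_lt_top (by simp) (Lp.memLp f).2)⟩, hle⟩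

/-- The integral operator with kernel `K` on `L²`. -/
def toCLM (hK : SchurKernel μ K w C) : Lp ℝ 2 μ →L[ℝ] Lp ℝ 2 μ :=
  LinearMap.mkContinuous
    { toFun := fun f => (hK.memLp_integral f).1.toLp
      map_add' := fun f g => by
        rw [← MemLp.toLp_add]
        refine MemLp.toLp_congr _ _ ?_
        filter_upwards [hK.ae_integrable f, hK.ae_integrable g] with x hf hg
        rw [Pi.add_apply, ← integral_add hf hg]
        refine integral_congr_ae ?_
        filter_upwards [Lp.coeFn_add f g] with t ht
        rw [ht, Pi.add_apply, mul_add]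
      map_smul' := fun c f => by
        rw [RingHom.id_apply, ← MemLp.toLp_const_smul]
        refine MemLp.toLp_congr _ _ ?_
        refine Eventually.of_forall fun x => ?_
        simp only [Pi.smul_apply, smul_eq_mul]
        rw [← integral_const_mul]
        refine integral_congr_ae ?_
        filter_upwards [Lp.coeFn_smul c f] with t ht
        simp only [ht, Pi.smul_apply, smul_eq_mul]
        ring } C
    (fun f => by
      change ‖(hK.memLp_integral f).1.toLp‖ ≤ _
      rw [Lp.norm_toLp, Lp.norm_def, ← ENNReal.toReal_ofReal hK.const_nonneg,
        ← ENNReal.toReal_mul]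
      exact ENNReal.toReal_mono
        (ENNReal.mul_ne_top ENNReal.ofReal_ne_top (Lp.memLp f).2.ne) (hK.memLp_integral f).2)

theorem norm_toCLM_le (hK : SchurKernel μ K w C) : ‖hK.toCLM‖ ≤ C :=
  LinearMap.mkContinuous_norm_le _ hK.const_nonneg _

theorem toCLM_ae_eq (hK : SchurKernel μ K w C) (f : Lp ℝ 2 μ) :
    hK.toCLM f =ᵐ[μ] fun x => ∫ t, K x t * f t ∂μ :=
  (hK.memLp_integral f).1.coeFn_toLp

theorem integrable_prod (hK : SchurKernel μ K w C) (f g : Lp ℝ 2 μ) :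
    Integrable (fun p : α × α => K p.1 p.2 * f p.2 * g p.1) (μ.prod μ) := by
  have hm : AEStronglyMeasurable (fun p : α × α => K p.1 p.2 * f p.2 * g p.1) (μ.prod μ) :=
    (hK.aestronglyMeasurable_prod f).mul (Lp.aestronglyMeasurable g).comp_fst
  refine ⟨hm, ?_⟩
  rw [hasFiniteIntegral_iff_enorm, lintegral_prod _ hm.enorm]
  have hF : AEMeasurable (fun x => ∫⁻ t, ‖K x t * f t‖ₑ ∂μ) μ :=
    (hK.aestronglyMeasurable_prod f).enorm.lintegral_prod_right'
  have hG : AEMeasurable (fun x => ‖g x‖ₑ) μ := (Lp.aestronglyMeasurable g).enorm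
  have h := ENNReal.lintegral_mul_le_Lp_mul_Lq μ Real.HolderConjugate.two_two hF hG
  refine lt_of_eq_of_lt ?_ (h.trans_lt ?_)
  · refine lintegral_congr fun x => ?_
    simp only [enorm_mul, Pi.mul_apply]
    refine lintegral_mul_const'' _ ?_
    exact ((hK.measurable.of_uncurry_left (x := x)).enorm.aemeasurable.mul
      (Lp.aestronglyMeasurable f).enorm)
  · simp only [ENNReal.rpow_ofNat]
    refine ENNReal.mul_lt_top (ENNReal.rpow_lt_top_of_nonneg (by norm_num) ?_)
      (ENNReal.rpow_lt_top_of_nonneg (by norm_num) (lintegral_enorm_sq_lt_top g).ne)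
    exact ((hK.lintegral_sq_le f).trans_lt
      (ENNReal.mul_lt_top (by simp) (lintegral_enorm_sq_lt_top f))).ne

theorem inner_toCLM (hK : SchurKernel μ K w C) (f g : Lp ℝ 2 μ) :
    ⟪hK.toCLM f, g⟫ = ∫ p : α × α, K p.1 p.2 * f p.2 * g p.1 ∂(μ.prod μ) := by
  rw [L2.inner_def, integral_prod _ (hK.integrable_prod f g)]
  refine integral_congr_ae ?_
  filter_upwards [hK.toCLM_ae_eq f] with x hx
  simp only [RCLike.inner_apply, conj_trivial]
  rw [hx, mul_comm, ← integral_mul_const]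

theorem toCLM_symmetric (hK : SchurKernel μ K w C) (f g : Lp ℝ 2 μ) :
    ⟪hK.toCLM f, g⟫ = ⟪f, hK.toCLM g⟫ := by
  rw [real_inner_comm (hK.toCLM g) f, hK.inner_toCLM, hK.inner_toCLM, ← integral_prod_swap]
  refine integral_congr_ae (Eventually.of_forall fun p => ?_)
  simp only [Prod.fst_swap, Prod.snd_swap, hK.symm p.2 p.1]
  ring

end SchurKernel

end SchurTest

theorem exists_maximal_eigenvalue_eq_norm {E : Type*} [NormedAddCommGroup E]
    [InnerProductSpace ℝ E] [CompleteSpace E] {T : E →L[ℝ] E} (hT : IsCompactOperator T)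
    (hsymm : ∀ f g : E, ⟪T f, g⟫ = ⟪f, T g⟫) (hpos : ∀ f : E, 0 ≤ ⟪T f, f⟫) (hT0 : T ≠ 0) :
    Module.End.HasEigenvalue (T : E →ₗ[ℝ] E) ‖T‖ ∧
      ∀ μ : ℝ, Module.End.HasEigenvalue (T : E →ₗ[ℝ] E) μ → μ ≤ ‖T‖ := by
  have : Nontrivial E := not_subsingleton_iff_nontrivial.1 fun _ =>
    hT0 (ContinuousLinearMap.ext fun _ => Subsingleton.elim _ _)
  constructor
  · by_contra h
    have hres : ‖T‖ ∈ resolventSet ℝ T :=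
      (hT.hasEigenvalue_or_mem_resolventSet (norm_ne_zero_iff.2 hT0)).resolve_left h
    obtain ⟨ε, hε, hle⟩ := T.rayleighQuotient_le_of_norm_mem_resolventSet (𝕜 := ℝ) hres
    have hs := T.norm_eq_iSup_rayleighQuotient (𝕜 := ℝ) hsymm
    have : ⨆ x, |T.rayleighQuotient x| ≤ ‖T‖ - ε := ciSup_le fun x => by
      rw [abs_of_nonneg]
      · exact hle x
      · exact div_nonneg (hpos x) (by positivity)
    linarith
  · intro μ hμ
    obtain ⟨f, hf⟩ := hμ.exists_hasEigenvector
    have h1 : ‖T f‖ = |μ| * ‖f‖ := by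
      rw [← Real.norm_eq_abs, ← norm_smul]; congr 1; exact hf.apply_eq_smul
    have h2 := T.le_opNorm f
    rw [h1] at h2
    exact (le_abs_self μ).trans (le_of_mul_le_mul_right h2 (norm_pos_iff.2 hf.2))

theorem isCompactOperator_of_forall_exists_norm_sub_le {E : Type*} [NormedAddCommGroup E]
    [NormedSpace ℝ E] [CompleteSpace E] {T : E →L[ℝ] E}
    (h : ∀ ε > 0, ∃ S : E →L[ℝ] E, IsCompactOperator S ∧ ‖T - S‖ ≤ ε) :
    IsCompactOperator T := by
  refine (isClosed_setOfPred_isCompactOperator (σ₁₂ := RingHom.id ℝ)).closure_subset (a := T) ?_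
  rw [Metric.mem_closure_iff]
  intro ε hε
  obtain ⟨S, hS, hle⟩ := h (ε / 2) (by positivity)
  exact ⟨S, hS, by rw [dist_eq_norm]; linarith⟩

section Doubling

variable {z z' : ℝ → ℝ}

/-- If `z` is a positive increasing antiderivative of `z'`, the logarithmic increment
`∫ z'/z` is at most the relative increment of `z`. -/
theorem integral_div_le_of_monotone (hpos : ∀ x, 0 < z x) (hmono : Monotone z)
    (hcont : Continuous z) (hz'0 : ∀ x, 0 ≤ z' x) (hint : ∀ a b, IntervalIntegrable z' volume a b)
    (hderiv : ∀ a b, z b - z a = ∫ t in a..b, z' t) {a b : ℝ} (hab : a ≤ b) :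
    ∫ t in a..b, z' t / z t ≤ (z b - z a) / z a := by
  rw [hderiv, ← intervalIntegral.integral_div]
  refine intervalIntegral.integral_mono_on hab
    ((hint a b).mul_continuousOn (hcont.inv₀ fun x => (hpos x).ne').continuousOn)
    ((hint a b).div_const _) fun t ht => ?_
  exact div_le_div_of_nonneg_left (hz'0 t) (hpos a) (hmono ht.1)

theorem half_nat_le_integral_div_of_two_pow_mul_le (hpos : ∀ x, 0 < z x) (hmono : Monotone z)
    (hcont : Continuous z) (hz'0 : ∀ x, 0 ≤ z' x) (hint : ∀ a b, IntervalIntegrable z' volume a b)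
    (hderiv : ∀ a b, z b - z a = ∫ t in a..b, z' t) (n : ℕ) {a b : ℝ} (hab : a ≤ b)
    (h : 2 ^ n * z a ≤ z b) : (n : ℝ) / 2 ≤ ∫ t in a..b, z' t / z t := by
  have hint' (a b : ℝ) : IntervalIntegrable (fun t => z' t / z t) volume a b :=
    (hint a b).mul_continuousOn (hcont.inv₀ fun x => (hpos x).ne').continuousOn
  induction n generalizing b with
  | zero =>
    simpa using intervalIntegral.integral_nonneg hab fun t _ => div_nonneg (hz'0 t) (hpos t).le
  | succ n ih =>
    have h1 : z a ≤ 2 ^ n * z a := le_mul_of_one_le_left (hpos a).le (one_le_pow₀ one_le_two)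
    have h2 : 2 * (2 ^ n * z a) ≤ z b := by rw [← mul_assoc, ← pow_succ']; exact h
    have h3 : 0 < 2 ^ n * z a := mul_pos (by positivity) (hpos a)
    obtain ⟨c, hc, hzc⟩ := intermediate_value_Icc hab hcont.continuousOn
      (show 2 ^ n * z a ∈ Set.Icc (z a) (z b) from ⟨h1, by linarith⟩)
    have hac := ih hc.1 hzc.ge
    have hcb : 1 / 2 ≤ ∫ t in c..b, z' t / z t := by
      have : (z b - z c) / z b ≤ ∫ t in c..b, z' t / z t := by
        rw [hderiv, ← intervalIntegral.integral_div]
        refine intervalIntegral.integral_mono_on hc.2 ((hint c b).div_const _) (hint' c b)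
          fun t ht => ?_
        exact div_le_div_of_nonneg_left (hz'0 t) (hpos t) (hmono ht.2)
      refine le_trans ?_ this
      rw [le_div_iff₀ (hpos b)]
      linarith
    rw [← intervalIntegral.integral_add_adjacent_intervals (hint' a c) (hint' c b)]
    push_cast
    linarith

end Doubling

section PrincipalSystem

variable {r q u v u' v' d₁ d₂ d : ℝ → ℝ}

namespace PFSS

/-- Reflection `x ↦ -x` exchanges the two members of a principal system; this records the
properties of `x ↦ u (-x)` needed to reuse statements about increasing solutions. -/
theorem reflected (hp : PFSS r q u v u' v') (a b : ℝ) :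
    IntervalIntegrable (fun x => -u' (-x)) volume a b ∧
      u (-b) - u (-a) = ∫ t in a..b, -u' (-t) := by
  constructor
  · have : IntervalIntegrable (fun x => u' (-x)) volume a b := by
      simpa using (hp.u'_intble (-a) (-b)).comp_sub_left 0
    exact this.neg
  · rw [hp.u_deriv, intervalIntegral.integral_neg, intervalIntegral.integral_comp_neg,
      ← intervalIntegral.integral_symm]

theorem continuous_u (hp : PFSS r q u v u' v') : Continuous u := by
  have : u = fun x => u 0 + ∫ t in (0:ℝ)..x, u' t := by
    ext x; rw [← hp.u_deriv]; ring
  rw [this]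
  exact continuous_const.add (intervalIntegral.continuous_primitive hp.u'_intble 0)

theorem continuous_v (hp : PFSS r q u v u' v') : Continuous v := by
  have : v = fun x => v 0 + ∫ t in (0:ℝ)..x, v' t := by
    ext x; rw [← hp.v_deriv]; ring
  rw [this]
  exact continuous_const.add (intervalIntegral.continuous_primitive hp.v'_intble 0)

theorem antitone_u (hp : PFSS r q u v u' v') : Antitone u := fun a b hab => by
  have h := intervalIntegral.integral_nonneg hab (f := fun t => -u' t)
    (fun t _ => neg_nonneg.2 (hp.u'_nonpos t)) (μ := volume)
  rw [intervalIntegral.integral_neg, ← hp.u_deriv] at h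
  linarith

theorem monotone_v (hp : PFSS r q u v u' v') : Monotone v := fun a b hab => by
  have h := intervalIntegral.integral_nonneg hab (f := v')
    (fun t _ => hp.v'_nonneg t) (μ := volume)
  rw [← hp.v_deriv] at h
  linarith

end PFSS

theorem Cond12.intervalIntegrable_one_div (hc : Cond12 r q) (a b : ℝ) :
    IntervalIntegrable (fun t => 1 / r t) volume a b :=
  (hc.2.2.2.2.1.integrableOn_isCompact isCompact_uIcc).intervalIntegrable

theorem Cond12.intervalIntegrable_q (hc : Cond12 r q) (a b : ℝ) :
    IntervalIntegrable q volume a b :=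
  (hc.2.2.2.2.2.integrableOn_isCompact isCompact_uIcc).intervalIntegrable

theorem Cond12.integral_one_div_pos (hc : Cond12 r q) {a b : ℝ} (hab : a < b) :
    0 < ∫ t in a..b, 1 / r t :=
  intervalIntegral.intervalIntegral_pos_of_pos (hc.intervalIntegrable_one_div a b)
    (fun t => one_div_pos.2 (hc.2.2.1 t)) hab

/-- Over an interval `[a, b]` on which the product of the masses of `1/r` and `q` is one, `r v'` at
the right end is comparable to `v / ∫ 1/r`. -/
theorem PFSS.v_bounds (hp : PFSS r q u v u' v') (hc : Cond12 r q) {a b : ℝ} (hab : a < b)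
    (h1 : (∫ t in a..b, 1 / r t) * (∫ t in a..b, q t) = 1) :
    r b * v' b * (∫ t in a..b, 1 / r t) ≤ 2 * v b ∧
      v b ≤ 2 * ((∫ t in a..b, 1 / r t) * (r b * v' b)) := by
  have hφ := hc.integral_one_div_pos hab
  set φ := ∫ t in a..b, 1 / r t with hφdef
  set Q := ∫ t in a..b, q t with hQ
  have hr := hc.2.2.1
  have hq := hc.2.2.2.1
  have hcv := hp.continuous_v
  have hmv := hp.monotone_v
  have hqv (a b : ℝ) : IntervalIntegrable (fun t => q t * v t) volume a b :=
    (hc.intervalIntegrable_q a b).mul_continuousOn hcv.continuousOn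
  have hP {s t : ℝ} (hst : s ≤ t) : r s * v' s ≤ r t * v' t := by
    have := intervalIntegral.integral_nonneg hst (f := fun t => q t * v t) (μ := volume)
      (fun t _ => mul_nonneg (hq t) (hp.v_pos t).le)
    rw [← hp.rv'_deriv] at this
    linarith
  have hv' (t : ℝ) : v' t = r t * v' t * (1 / r t) := by field_simp [(hr t).ne']
  have e1 : r a * v' a * φ ≤ v b - v a := by
    rw [hp.v_deriv, hφdef, ← intervalIntegral.integral_const_mul]
    refine intervalIntegral.integral_mono_on hab.le
      ((hc.intervalIntegrable_one_div a b).const_mul _) (hp.v'_intble a b) fun t ht => ?_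
    rw [hv' t]
    exact mul_le_mul_of_nonneg_right (hP ht.1) (one_div_pos.2 (hr t)).le
  have e2 : v b - v a ≤ r b * v' b * φ := by
    rw [hp.v_deriv, hφdef, ← intervalIntegral.integral_const_mul]
    refine intervalIntegral.integral_mono_on hab.le
      (hp.v'_intble a b) ((hc.intervalIntegrable_one_div a b).const_mul _) fun t ht => ?_
    rw [hv' t]
    exact mul_le_mul_of_nonneg_right (hP ht.2) (one_div_pos.2 (hr t)).le
  have e3 : r b * v' b - r a * v' a ≤ Q * v b := by
    rw [hp.rv'_deriv, hQ, ← intervalIntegral.integral_mul_const]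
    refine intervalIntegral.integral_mono_on hab.le (hqv a b)
      ((hc.intervalIntegrable_q a b).mul_const _) fun t ht => ?_
    exact mul_le_mul_of_nonneg_left (hmv ht.2) (hq t)
  have e4 : Q * v a ≤ r b * v' b - r a * v' a := by
    rw [hp.rv'_deriv, hQ, ← intervalIntegral.integral_mul_const]
    refine intervalIntegral.integral_mono_on hab.le
      ((hc.intervalIntegrable_q a b).mul_const _) (hqv a b) fun t ht => ?_
    exact mul_le_mul_of_nonneg_left (hmv ht.1) (hq t)
  have hPa : 0 ≤ r a * v' a := mul_nonneg (hr a).le (hp.v'_nonneg a)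
  have hva := hp.v_pos a
  have e3' : φ * (r b * v' b - r a * v' a) ≤ v b :=
    calc _ ≤ φ * (Q * v b) := mul_le_mul_of_nonneg_left e3 hφ.le
      _ = φ * Q * v b := by ring
      _ = v b := by rw [h1, one_mul]
  have e4' : v a ≤ φ * (r b * v' b - r a * v' a) :=
    calc v a = φ * Q * v a := by rw [h1, one_mul]
      _ = φ * (Q * v a) := by ring
      _ ≤ _ := mul_le_mul_of_nonneg_left e4 hφ.le
  have e5 : 0 ≤ φ * (r a * v' a) := mul_nonneg hφ.le hPa
  constructor <;> linarith

/-- Over an interval `[a, b]` on which the product of the masses of `1/r` and `q` is one, `-r u'` at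
the left end is comparable to `u / ∫ 1/r`. -/
theorem PFSS.u_bounds (hp : PFSS r q u v u' v') (hc : Cond12 r q) {a b : ℝ} (hab : a < b)
    (h1 : (∫ t in a..b, 1 / r t) * (∫ t in a..b, q t) = 1) :
    -(r a * u' a) * (∫ t in a..b, 1 / r t) ≤ 2 * u a ∧
      u a ≤ 2 * ((∫ t in a..b, 1 / r t) * -(r a * u' a)) := by
  have hφ := hc.integral_one_div_pos hab
  set φ := ∫ t in a..b, 1 / r t with hφdef
  set Q := ∫ t in a..b, q t with hQ
  have hr := hc.2.2.1
  have hq := hc.2.2.2.1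
  have hcu := hp.continuous_u
  have hmu := hp.antitone_u
  have hqu (a b : ℝ) : IntervalIntegrable (fun t => q t * u t) volume a b :=
    (hc.intervalIntegrable_q a b).mul_continuousOn hcu.continuousOn
  have hP {s t : ℝ} (hst : s ≤ t) : r s * u' s ≤ r t * u' t := by
    have := intervalIntegral.integral_nonneg hst (f := fun t => q t * u t) (μ := volume)
      (fun t _ => mul_nonneg (hq t) (hp.u_pos t).le)
    rw [← hp.ru'_deriv] at this
    linarith
  have hu' (t : ℝ) : u' t = r t * u' t * (1 / r t) := by field_simp [(hr t).ne']
  have e1 : r a * u' a * φ ≤ u b - u a := by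
    rw [hp.u_deriv, hφdef, ← intervalIntegral.integral_const_mul]
    refine intervalIntegral.integral_mono_on hab.le
      ((hc.intervalIntegrable_one_div a b).const_mul _) (hp.u'_intble a b) fun t ht => ?_
    rw [hu' t]
    exact mul_le_mul_of_nonneg_right (hP ht.1) (one_div_pos.2 (hr t)).le
  have e2 : u b - u a ≤ r b * u' b * φ := by
    rw [hp.u_deriv, hφdef, ← intervalIntegral.integral_const_mul]
    refine intervalIntegral.integral_mono_on hab.le
      (hp.u'_intble a b) ((hc.intervalIntegrable_one_div a b).const_mul _) fun t ht => ?_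
    rw [hu' t]
    exact mul_le_mul_of_nonneg_right (hP ht.2) (one_div_pos.2 (hr t)).le
  have e3 : r b * u' b - r a * u' a ≤ Q * u a := by
    rw [hp.ru'_deriv, hQ, ← intervalIntegral.integral_mul_const]
    refine intervalIntegral.integral_mono_on hab.le (hqu a b)
      ((hc.intervalIntegrable_q a b).mul_const _) fun t ht => ?_
    exact mul_le_mul_of_nonneg_left (hmu ht.1) (hq t)
  have e4 : Q * u b ≤ r b * u' b - r a * u' a := by
    rw [hp.ru'_deriv, hQ, ← intervalIntegral.integral_mul_const]
    refine intervalIntegral.integral_mono_on hab.le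
      ((hc.intervalIntegrable_q a b).mul_const _) (hqu a b) fun t ht => ?_
    exact mul_le_mul_of_nonneg_left (hmu ht.2) (hq t)
  have hPb : r b * u' b ≤ 0 := mul_nonpos_of_nonneg_of_nonpos (hr b).le (hp.u'_nonpos b)
  have hub := hp.u_pos b
  have e3' : φ * (r b * u' b - r a * u' a) ≤ u a :=
    calc _ ≤ φ * (Q * u a) := mul_le_mul_of_nonneg_left e3 hφ.le
      _ = φ * Q * u a := by ring
      _ = u a := by rw [h1, one_mul]
  have e4' : u b ≤ φ * (r b * u' b - r a * u' a) :=
    calc u b = φ * Q * u b := by rw [h1, one_mul]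
      _ = φ * (Q * u b) := by ring
      _ ≤ _ := mul_le_mul_of_nonneg_left e4 hφ.le
  have e5 : φ * (r b * u' b) ≤ 0 := mul_nonpos_of_nonneg_of_nonpos hφ.le hPb
  constructor <;> linarith

theorem hF_pos (hc : Cond12 r q) (h₁ : IsD1 r q d₁) (h₂ : IsD2 r q d₂) (x : ℝ) :
    0 < hF r d₁ d₂ x := by
  have h3 : 0 < phiF r d₁ x := hc.integral_one_div_pos (by linarith [(h₁ x).1])
  have h4 : 0 < psiF r d₂ x := hc.integral_one_div_pos (by linarith [(h₂ x).1])
  unfold hF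
  positivity

/-- The product `u v` is comparable to `h`. -/
theorem PFSS.hF_le_and_le_hF (hp : PFSS r q u v u' v') (hc : Cond12 r q) (h₁ : IsD1 r q d₁)
    (h₂ : IsD2 r q d₂) (x : ℝ) :
    hF r d₁ d₂ x ≤ 2 * (u x * v x) ∧ u x * v x ≤ 2 * hF r d₁ d₂ x := by
  have h3 : 0 < phiF r d₁ x := hc.integral_one_div_pos (by linarith [(h₁ x).1])
  have h4 : 0 < psiF r d₂ x := hc.integral_one_div_pos (by linarith [(h₂ x).1])
  obtain ⟨a1, a2⟩ := hp.v_bounds hc (a := x - d₁ x) (b := x) (by linarith [(h₁ x).1]) (h₁ x).2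
  obtain ⟨b1, b2⟩ := hp.u_bounds hc (a := x) (b := x + d₂ x) (by linarith [(h₂ x).1]) (h₂ x).2
  change r x * v' x * phiF r d₁ x ≤ _ at a1
  change _ ≤ 2 * (phiF r d₁ x * _) at a2
  change _ * psiF r d₂ x ≤ _ at b1
  change _ ≤ 2 * (psiF r d₂ x * _) at b2
  have hw := hp.wronskian x
  have hu := hp.u_pos x
  have hv := hp.v_pos x
  unfold hF
  set φ := phiF r d₁ x
  set ψ := psiF r d₂ x
  have A1 := mul_le_mul_of_nonneg_right a1 hu.le
  have A2 := mul_le_mul_of_nonneg_right a2 hu.le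
  have B1 := mul_le_mul_of_nonneg_right b1 hv.le
  have B2 := mul_le_mul_of_nonneg_right b2 hv.le
  have A1' := mul_le_mul_of_nonneg_right A1 h4.le
  have A2' := mul_le_mul_of_nonneg_right A2 h4.le
  have B1' := mul_le_mul_of_nonneg_right B1 h3.le
  have B2' := mul_le_mul_of_nonneg_right B2 h3.le
  have hw' : φ * ψ = φ * ψ * (r x * (v' x * u x - u' x * v x)) := by rw [hw, mul_one]
  constructor
  · rw [div_le_iff₀ (by positivity)]
    linarith
  · rw [← mul_div_assoc, le_div_iff₀ (by positivity)]
    linarith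

namespace PFSS

theorem one_div_eq (hp : PFSS r q u v u' v') (hc : Cond12 r q) (x : ℝ) :
    1 / (r x * (u x * v x)) = v' x / v x + -u' x / u x := by
  have hr := hc.2.2.1 x
  have hu := hp.u_pos x
  have hv := hp.v_pos x
  rw [← hp.wronskian x]
  field_simp
  ring

theorem intervalIntegrable_v_div (hp : PFSS r q u v u' v') (a b : ℝ) :
    IntervalIntegrable (fun t => v' t / v t) volume a b :=
  (hp.v'_intble a b).mul_continuousOn
    (hp.continuous_v.inv₀ fun x => (hp.v_pos x).ne').continuousOn

theorem intervalIntegrable_u_div (hp : PFSS r q u v u' v') (a b : ℝ) :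
    IntervalIntegrable (fun t => -u' t / u t) volume a b :=
  (hp.u'_intble a b).neg.mul_continuousOn
    (hp.continuous_u.inv₀ fun x => (hp.u_pos x).ne').continuousOn

theorem intervalIntegrable_one_div (hp : PFSS r q u v u' v') (hc : Cond12 r q) (a b : ℝ) :
    IntervalIntegrable (fun t => 1 / (r t * (u t * v t))) volume a b := by
  simp_rw [hp.one_div_eq hc]
  exact (hp.intervalIntegrable_v_div a b).add (hp.intervalIntegrable_u_div a b)

theorem integral_one_div_eq (hp : PFSS r q u v u' v') (hc : Cond12 r q) (a b : ℝ) :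
    ∫ t in a..b, 1 / (r t * (u t * v t)) =
      (∫ t in a..b, v' t / v t) + ∫ t in a..b, -u' t / u t := by
  simp_rw [hp.one_div_eq hc]
  exact intervalIntegral.integral_add (hp.intervalIntegrable_v_div a b)
    (hp.intervalIntegrable_u_div a b)

theorem integral_u_div_eq (a b : ℝ) :
    ∫ t in a..b, -u' t / u t = ∫ t in -b..-a, -u' (-t) / u (-t) := by
  rw [intervalIntegral.integral_comp_neg (fun t => -u' t / u t), neg_neg, neg_neg]

theorem integral_one_div_le (hp : PFSS r q u v u' v') (hc : Cond12 r q) {a b : ℝ} (hab : a ≤ b) :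
    ∫ t in a..b, 1 / (r t * (u t * v t)) ≤ (v b - v a) / v a + (u a - u b) / u b := by
  rw [hp.integral_one_div_eq hc]
  refine add_le_add (integral_div_le_of_monotone hp.v_pos hp.monotone_v hp.continuous_v
    hp.v'_nonneg hp.v'_intble hp.v_deriv hab) ?_
  rw [integral_u_div_eq]
  have := integral_div_le_of_monotone (z := fun x => u (-x)) (z' := fun x => -u' (-x))
    (fun x => hp.u_pos _) (fun x y h => hp.antitone_u (neg_le_neg h))
    (hp.continuous_u.comp continuous_neg) (fun x => neg_nonneg.2 (hp.u'_nonpos _))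
    (fun a b => (hp.reflected a b).1) (fun a b => (hp.reflected a b).2) (neg_le_neg hab)
  simpa using this

theorem lt_of_integral_one_div_le_two (hp : PFSS r q u v u' v') (hc : Cond12 r q) {a b : ℝ}
    (hab : a ≤ b) (h : ∫ t in a..b, 1 / (r t * (u t * v t)) ≤ 2) :
    v b < 32 * v a ∧ u a < 32 * u b := by
  rw [hp.integral_one_div_eq hc] at h
  have hv0 : 0 ≤ ∫ t in a..b, v' t / v t :=
    intervalIntegral.integral_nonneg hab fun t _ => div_nonneg (hp.v'_nonneg t) (hp.v_pos t).le
  have hu0 : 0 ≤ ∫ t in a..b, -u' t / u t := intervalIntegral.integral_nonneg hab fun t _ =>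
    div_nonneg (neg_nonneg.2 (hp.u'_nonpos t)) (hp.u_pos t).le
  constructor
  · by_contra hlt
    have := half_nat_le_integral_div_of_two_pow_mul_le hp.v_pos hp.monotone_v hp.continuous_v
      hp.v'_nonneg hp.v'_intble hp.v_deriv 5 hab (by norm_num; linarith)
    norm_num at this
    linarith
  · by_contra hlt
    have := half_nat_le_integral_div_of_two_pow_mul_le (z := fun x => u (-x))
      (z' := fun x => -u' (-x)) (fun x => hp.u_pos _)
      (fun x y h => hp.antitone_u (neg_le_neg h)) (hp.continuous_u.comp continuous_neg)
      (fun x => neg_nonneg.2 (hp.u'_nonpos _)) (fun a b => (hp.reflected a b).1)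
      (fun a b => (hp.reflected a b).2) 5 (neg_le_neg hab) (by simp only [neg_neg]; linarith)
    rw [← integral_u_div_eq] at this
    norm_num at this
    linarith

end PFSS

end PrincipalSystem

/-- A pair of positive continuous functions, the first decreasing and the second increasing. -/
structure GreenPair (u v : ℝ → ℝ) : Prop where
  u_pos : ∀ x, 0 < u x
  v_pos : ∀ x, 0 < v x
  antitone_u : Antitone u
  monotone_v : Monotone v
  continuous_u : Continuous u
  continuous_v : Continuous v

theorem PFSS.greenPair {r q u v u' v' : ℝ → ℝ} (hp : PFSS r q u v u' v') : GreenPair u v :=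
  ⟨hp.u_pos, hp.v_pos, hp.antitone_u, hp.monotone_v, hp.continuous_u, hp.continuous_v⟩

/-- The logarithm of `v / u`. -/
def logRatio (u v : ℝ → ℝ) (x : ℝ) : ℝ := Real.log (v x) - Real.log (u x)

/-- The weight `u v` at `t`, damped exponentially in the `logRatio`-distance from `x`. -/
def dampedWeight (u v : ℝ → ℝ) (x t : ℝ) : ℝ :=
  u t * v t * Real.exp (-|logRatio u v x - logRatio u v t| / 2)

/-- The restriction of the Green kernel to the diagonal blocks `k x = k t`. -/
def blockKernel (k : ℝ → ℤ) (u v : ℝ → ℝ) (x t : ℝ) : ℝ :=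
  if k x = k t then greenKernel u v x t else 0

namespace GreenPair

variable {u v : ℝ → ℝ}

theorem monotone_logRatio (h : GreenPair u v) : Monotone (logRatio u v) := fun _ _ hab =>
  sub_le_sub (Real.log_le_log (h.v_pos _) (h.monotone_v hab))
    (Real.log_le_log (h.u_pos _) (h.antitone_u hab))

theorem continuous_logRatio (h : GreenPair u v) : Continuous (logRatio u v) :=
  (h.continuous_v.log fun x => (h.v_pos x).ne').sub
    (h.continuous_u.log fun x => (h.u_pos x).ne')

theorem continuous_dampedWeight (h : GreenPair u v) (x : ℝ) :
    Continuous (dampedWeight u v x) := by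
  have := h.continuous_logRatio
  have := h.continuous_u
  have := h.continuous_v
  unfold dampedWeight
  fun_prop

theorem dampedWeight_nonneg (h : GreenPair u v) (x t : ℝ) : 0 ≤ dampedWeight u v x t :=
  mul_nonneg (mul_pos (h.u_pos t) (h.v_pos t)).le (Real.exp_pos _).le

theorem dampedWeight_le (h : GreenPair u v) (x t : ℝ) : dampedWeight u v x t ≤ u t * v t := by
  refine mul_le_of_le_one_right (mul_pos (h.u_pos t) (h.v_pos t)).le ?_
  rw [Real.exp_le_one_iff]
  linarith [abs_nonneg (logRatio u v x - logRatio u v t)]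

theorem sqrt_mul_eq (h : GreenPair u v) (x : ℝ) :
    √(u x * v x) = Real.exp ((Real.log (u x) + Real.log (v x)) / 2) := by
  rw [Real.exp_half, Real.exp_add, Real.exp_log (h.u_pos x), Real.exp_log (h.v_pos x)]

theorem greenKernel_comm (u v : ℝ → ℝ) (x t : ℝ) :
    greenKernel u v x t = greenKernel u v t x := by
  unfold greenKernel
  rcases lt_trichotomy x t with h | rfl | h
  · simp [h.le, h.not_ge]
  · rfl
  · simp [h.le, h.not_ge]

theorem greenKernel_pos (h : GreenPair u v) (x t : ℝ) : 0 < greenKernel u v x t := by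
  unfold greenKernel
  split_ifs
  exacts [mul_pos (h.u_pos _) (h.v_pos _), mul_pos (h.u_pos _) (h.v_pos _)]

theorem greenKernel_eq (h : GreenPair u v) (x t : ℝ) :
    greenKernel u v x t = √(u x * v x) * √(u t * v t) *
      Real.exp (-|logRatio u v x - logRatio u v t| / 2) := by
  wlog hxt : t ≤ x generalizing x t
  · rw [greenKernel_comm, this t x (le_of_not_ge hxt), abs_sub_comm]
    ring
  rw [abs_of_nonneg (sub_nonneg.2 (h.monotone_logRatio hxt)), h.sqrt_mul_eq, h.sqrt_mul_eq,
    ← Real.exp_add, ← Real.exp_add, greenKernel, if_pos hxt]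
  nth_rewrite 1 [← Real.exp_log (h.u_pos x), ← Real.exp_log (h.v_pos t)]
  rw [← Real.exp_add]
  unfold logRatio
  ring_nf

theorem mul_le_mul_exp (h : GreenPair u v) (x t : ℝ) :
    u t * v t ≤ u x * v x * Real.exp |logRatio u v x - logRatio u v t| := by
  rw [← Real.exp_log (h.u_pos x), ← Real.exp_log (h.v_pos x), ← Real.exp_log (h.u_pos t),
    ← Real.exp_log (h.v_pos t), ← Real.exp_add, ← Real.exp_add, ← Real.exp_add, Real.exp_le_exp]
  rcases le_total x t with hxt | hxt
  · have h1 := Real.log_le_log (h.v_pos _) (h.monotone_v hxt)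
    have h2 := Real.log_le_log (h.u_pos _) (h.antitone_u hxt)
    have h3 := neg_abs_le (logRatio u v x - logRatio u v t)
    unfold logRatio at *
    linarith
  · have h1 := Real.log_le_log (h.v_pos _) (h.monotone_v hxt)
    have h2 := Real.log_le_log (h.u_pos _) (h.antitone_u hxt)
    have h3 := le_abs_self (logRatio u v x - logRatio u v t)
    unfold logRatio at *
    linarith

theorem measurable_greenKernel (h : GreenPair u v) :
    Measurable (Function.uncurry (greenKernel u v)) := by
  have hu := h.continuous_u.measurable
  have hv := h.continuous_v.measurable
  exact Measurable.ite (measurableSet_le measurable_snd measurable_fst)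
    ((hu.comp measurable_fst).mul (hv.comp measurable_snd))
    ((hu.comp measurable_snd).mul (hv.comp measurable_fst))

theorem schurKernel_blockKernel (h : GreenPair u v) {k : ℝ → ℤ} (hk : Measurable k) {C : ℝ}
    (hC : 0 ≤ C)
    (hb : ∀ x, ∫⁻ t in {t | k t = k x}, ENNReal.ofReal (dampedWeight u v x t) ≤ ENNReal.ofReal C) :
    SchurKernel volume (blockKernel k u v) (fun x => √(u x * v x)) C where
  measurable := Measurable.ite
    (measurableSet_eq_fun (hk.comp measurable_fst) (hk.comp measurable_snd))
    h.measurable_greenKernel measurable_const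
  symm x t := by unfold blockKernel; rw [greenKernel_comm]; simp only [eq_comm]
  nonneg x t := by unfold blockKernel; split_ifs; exacts [(h.greenKernel_pos x t).le, le_rfl]
  weight_measurable := (h.continuous_u.mul h.continuous_v).sqrt.measurable
  weight_pos x := Real.sqrt_pos.2 (mul_pos (h.u_pos x) (h.v_pos x))
  const_nonneg := hC
  bound x := by
    have hS : MeasurableSet {t | k t = k x} := hk (measurableSet_singleton (k x))
    rw [mul_comm, ENNReal.ofReal_mul (Real.sqrt_nonneg _)]
    calc ∫⁻ t, ENNReal.ofReal (blockKernel k u v x t * √(u t * v t))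
        = ∫⁻ t, ENNReal.ofReal √(u x * v x) *
            {t | k t = k x}.indicator (fun t => ENNReal.ofReal (dampedWeight u v x t)) t := by
          refine lintegral_congr fun t => ?_
          by_cases hkt : t ∈ {t | k t = k x}
          · rw [Set.indicator_of_mem hkt, ← ENNReal.ofReal_mul (Real.sqrt_nonneg _), blockKernel,
              if_pos (Eq.symm hkt), h.greenKernel_eq, dampedWeight]
            congr 1
            have := Real.mul_self_sqrt (mul_pos (h.u_pos t) (h.v_pos t)).le
            linear_combination
              (√(u x * v x) * Real.exp (-|logRatio u v x - logRatio u v t| / 2)) * this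
          · rw [Set.indicator_of_notMem hkt, blockKernel, if_neg fun hk => hkt hk.symm]
            simp
      _ = ENNReal.ofReal √(u x * v x) *
            ∫⁻ t in {t | k t = k x}, ENNReal.ofReal (dampedWeight u v x t) := by
          rw [lintegral_const_mul _
            ((h.continuous_dampedWeight x).measurable.ennreal_ofReal.indicator hS),
            lintegral_indicator hS]
      _ ≤ _ := by gcongr; exact hb x

theorem schurKernel_greenKernel (h : GreenPair u v) {C : ℝ} (hC : 0 ≤ C)
    (hb : ∀ x, ∫⁻ t, ENNReal.ofReal (dampedWeight u v x t) ≤ ENNReal.ofReal C) :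
    SchurKernel volume (greenKernel u v) (fun x => √(u x * v x)) C := by
  have := h.schurKernel_blockKernel (k := fun _ => 0) measurable_const hC (by simpa using hb)
  have he : blockKernel (fun _ => 0) u v = greenKernel u v := by
    ext x t; simp [blockKernel]
  rwa [he] at this

/-- Positivity of the Green form: the kernel is a superposition of squares, because
`greenKernel u v x t = u x * u t * min (v x / u x) (v t / u t)`. -/
theorem integral_greenKernel_nonneg (h : GreenPair u v) {f : ℝ → ℝ}
    (hfm : AEStronglyMeasurable f volume)
    (hf : Integrable (fun p : ℝ × ℝ => greenKernel u v p.1 p.2 * f p.2 * f p.1)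
      (volume.prod volume)) :
    0 ≤ ∫ p : ℝ × ℝ, greenKernel u v p.1 p.2 * f p.2 * f p.1 ∂(volume.prod volume) := by
  set τ : ℝ → ℝ := fun x => v x / u x with hτ
  have hτm : Measurable τ := h.continuous_v.measurable.div h.continuous_u.measurable
  have hτpos (x : ℝ) : 0 < τ x := div_pos (h.v_pos x) (h.u_pos x)
  have hτmono : Monotone τ := fun x y hxy =>
    div_le_div₀ (h.v_pos y).le (h.monotone_v hxy) (h.u_pos y) (h.antitone_u hxy)
  have hker (x t : ℝ) : greenKernel u v x t = u x * u t * min (τ x) (τ t) := by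
    have hx := (h.u_pos x).ne'
    have ht := (h.u_pos t).ne'
    unfold greenKernel
    split_ifs with hxt
    · rw [min_eq_right (hτmono hxt), hτ]
      field_simp
    · rw [min_eq_left (hτmono (le_of_not_ge hxt)), hτ]
      field_simp
  set S : ℝ → ℝ → ℝ := fun s x => if s < τ x then u x * f x else 0 with hS
  set H : ℝ × (ℝ × ℝ) → ℝ := fun p => S p.1 p.2.1 * S p.1 p.2.2 with hH
  set ν : Measure ℝ := volume.restrict (Set.Ioi 0) with hν
  have hSprod (s x t : ℝ) : S s x * S s t =
      (Set.Iio (min (τ x) (τ t))).indicator (fun _ => u x * f x * (u t * f t)) s := by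
    simp only [hS, Set.indicator, Set.mem_Iio, lt_min_iff]
    by_cases h1 : s < τ x <;> by_cases h2 : s < τ t <;> simp [h1, h2]
  have hIio (x t : ℝ) : ν.real (Set.Iio (min (τ x) (τ t))) = min (τ x) (τ t) := by
    rw [hν, measureReal_restrict_apply measurableSet_Iio, Set.Iio_inter_Ioi,
      Real.volume_real_Ioo_of_le (le_min (hτpos x).le (hτpos t).le), sub_zero]
  have hIiofin (x t : ℝ) : ν (Set.Iio (min (τ x) (τ t))) ≠ ⊤ := by
    rw [hν, Measure.restrict_apply measurableSet_Iio, Set.Iio_inter_Ioi]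
    simp
  have hHm : AEStronglyMeasurable H (ν.prod (volume.prod volume)) := by
    have hset : MeasurableSet {p : ℝ × ℝ | p.1 < τ p.2} :=
      measurableSet_lt measurable_fst (hτm.comp measurable_snd)
    have hSm : AEStronglyMeasurable (Function.uncurry S) (ν.prod volume) := by
      have := ((h.continuous_u.aestronglyMeasurable (μ := volume)).mul hfm).comp_snd (μ := ν)
      refine (this.indicator hset).congr (Eventually.of_forall fun p => ?_)
      simp only [Set.indicator, Set.mem_ofPred_eq, hS, Function.uncurry]
      rfl
    have h1 : Measure.QuasiMeasurePreserving (fun p : ℝ × (ℝ × ℝ) => (p.1, p.2.1))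
        (ν.prod (volume.prod volume)) (ν.prod volume) :=
      MeasureTheory.QuasiMeasurePreserving.prodMap (.id ν) Measure.quasiMeasurePreserving_fst
    have h2 : Measure.QuasiMeasurePreserving (fun p : ℝ × (ℝ × ℝ) => (p.1, p.2.2))
        (ν.prod (volume.prod volume)) (ν.prod volume) :=
      MeasureTheory.QuasiMeasurePreserving.prodMap (.id ν) Measure.quasiMeasurePreserving_snd
    exact (hSm.comp_quasiMeasurePreserving h1).mul (hSm.comp_quasiMeasurePreserving h2)
  have hHint : Integrable H (ν.prod (volume.prod volume)) := by
    rw [integrable_prod_iff' hHm]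
    refine ⟨Eventually.of_forall fun p => ?_, ?_⟩
    · simp only [hH, hSprod]
      exact (integrable_indicator_iff measurableSet_Iio).2 (integrableOn_const (hIiofin _ _))
    · refine hf.norm.congr (Eventually.of_forall fun p => ?_)
      simp only [hH, hSprod, norm_indicator_eq_indicator_norm]
      rw [integral_indicator measurableSet_Iio, setIntegral_const, hIio, hker]
      simp only [norm_mul, Real.norm_eq_abs, smul_eq_mul, abs_of_pos (h.u_pos _),
        abs_of_pos (lt_min (hτpos p.1) (hτpos p.2))]
      ring
  have hswap := integral_integral_swap (f := fun s p => H (s, p)) hHint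
  have hL : ∫ p : ℝ × ℝ, greenKernel u v p.1 p.2 * f p.2 * f p.1 ∂(volume.prod volume) =
      ∫ p : ℝ × ℝ, (∫ s, H (s, p) ∂ν) ∂(volume.prod volume) := by
    refine integral_congr_ae (Eventually.of_forall fun p => ?_)
    simp only [hH, hSprod]
    rw [integral_indicator measurableSet_Iio, setIntegral_const, hIio, hker, smul_eq_mul]
    ring
  rw [hL, ← hswap]
  refine integral_nonneg fun s => ?_
  simp only [hH]
  rw [integral_prod_mul (S s) (S s)]
  exact mul_self_nonneg _

variable {η : ℝ → ℝ}

theorem exp_logRatio (h : GreenPair u v) (x : ℝ) : Real.exp (logRatio u v x) = v x / u x := by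
  rw [logRatio, Real.exp_sub, Real.exp_log (h.v_pos x), Real.exp_log (h.u_pos x)]

theorem v_le_mul_exp (h : GreenPair u v) {a b : ℝ} (hab : a ≤ b) :
    v b ≤ v a * Real.exp (logRatio u v b - logRatio u v a) := by
  nth_rewrite 1 [← Real.exp_log (h.v_pos b)]
  nth_rewrite 1 [← Real.exp_log (h.v_pos a)]
  rw [← Real.exp_add, Real.exp_le_exp]
  have := Real.log_le_log (h.u_pos _) (h.antitone_u hab)
  unfold logRatio
  linarith

theorem u_le_mul_exp (h : GreenPair u v) {a b : ℝ} (hab : a ≤ b) :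
    u a ≤ u b * Real.exp (logRatio u v b - logRatio u v a) := by
  nth_rewrite 1 [← Real.exp_log (h.u_pos a)]
  nth_rewrite 1 [← Real.exp_log (h.u_pos b)]
  rw [← Real.exp_add, Real.exp_le_exp]
  have := Real.log_le_log (h.v_pos _) (h.monotone_v hab)
  unfold logRatio
  linarith

/-- If the mass of `u v` over intervals of small `logRatio`-length is at most `8 A` throughout a
closed interval `J`, then so is, up to a constant, the exponentially damped mass over `J`. -/
theorem setLIntegral_dampedWeight_le (h : GreenPair u v)
    (hbot : Tendsto (logRatio u v) atBot atBot) (htop : Tendsto (logRatio u v) atTop atTop)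
    (hη : ∀ a b, a ≤ b → logRatio u v b - logRatio u v a ≤ 1 / 8 →
      ∫⁻ t in Set.Icc a b, ENNReal.ofReal (u t * v t) ≤ ENNReal.ofReal (8 * η ((a + b) / 2)))
    {J : Set ℝ} (hJ : IsClosed J) (hJo : J.OrdConnected) {A : ℝ} (hA0 : 0 ≤ A)
    (hA : ∀ x ∈ J, η x ≤ A) (x : ℝ) :
    ∫⁻ t in J, ENNReal.ofReal (dampedWeight u v x t) ≤
      ENNReal.ofReal (16 * A * (1 - Real.exp (-(1 / 16)))⁻¹) := by
  set θ := logRatio u v with hθ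
  have hS (α : ℝ) : ∫⁻ t in J ∩ θ ⁻¹' Set.Icc α (α + 1 / 8), ENNReal.ofReal (u t * v t) ≤
      ENNReal.ofReal (8 * A) := by
    rcases (J ∩ θ ⁻¹' Set.Icc α (α + 1 / 8)).eq_empty_or_nonempty with he | hne
    · rw [he]; simp
    obtain ⟨L, hL⟩ := (hbot.eventually_lt_atBot α).exists_forall_of_atBot
    obtain ⟨M, hM⟩ := (htop.eventually_gt_atTop (α + 1 / 8)).exists_forall_of_atTop
    have hsub : J ∩ θ ⁻¹' Set.Icc α (α + 1 / 8) ⊆ Set.Icc L M := fun t ht =>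
      ⟨le_of_not_ge fun hle => absurd (hL t hle) (not_lt.2 ht.2.1),
        le_of_not_ge fun hle => absurd (hM t hle) (not_lt.2 ht.2.2)⟩
    have hcomp : IsCompact (J ∩ θ ⁻¹' Set.Icc α (α + 1 / 8)) :=
      isCompact_Icc.of_isClosed_subset
        (hJ.inter (isClosed_Icc.preimage h.continuous_logRatio)) hsub
    obtain ⟨a, ha, hal⟩ := hcomp.exists_isLeast hne
    obtain ⟨b, hb, hbg⟩ := hcomp.exists_isGreatest hne
    have hab : a ≤ b := hal hb
    have hsub' : J ∩ θ ⁻¹' Set.Icc α (α + 1 / 8) ⊆ Set.Icc a b := fun t ht => ⟨hal ht, hbg ht⟩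
    refine (lintegral_mono_set hsub').trans
      ((hη a b hab (by linarith [hb.2.2, ha.2.1])).trans ?_)
    have := hA _ (hJo.out ha.1 hb.1 ⟨by linarith, by linarith⟩ : (a + b) / 2 ∈ J)
    exact ENNReal.ofReal_le_ofReal (by linarith)
  set T : ℕ → Set ℝ := fun n => {t | t ∈ J ∧ (n : ℝ) / 8 ≤ |θ x - θ t| ∧
    |θ x - θ t| ≤ (n + 1) / 8} with hT
  have hcover : J ⊆ ⋃ n, T n := fun t ht => by
    refine Set.mem_iUnion.2 ⟨⌊8 * |θ x - θ t|⌋₊, ht, ?_, ?_⟩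
    · linarith [Nat.floor_le (a := 8 * |θ x - θ t|) (by positivity)]
    · linarith [Nat.lt_floor_add_one (8 * |θ x - θ t|)]
  have hTn (n : ℕ) : ∫⁻ t in T n, ENNReal.ofReal (dampedWeight u v x t) ≤
      ENNReal.ofReal (16 * A * Real.exp (-(1 / 16)) ^ n) := by
    have hTsub : T n ⊆ (J ∩ θ ⁻¹' Set.Icc (θ x + n / 8) (θ x + n / 8 + 1 / 8)) ∪
        (J ∩ θ ⁻¹' Set.Icc (θ x - (n + 1) / 8) (θ x - (n + 1) / 8 + 1 / 8)) := by
      rintro t ⟨htJ, h1, h2⟩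
      rcases le_total (θ x) (θ t) with hle | hle
      · rw [abs_of_nonpos (by linarith)] at h1 h2
        exact Or.inl ⟨htJ, by linarith, by linarith⟩
      · rw [abs_of_nonneg (by linarith)] at h1 h2
        exact Or.inr ⟨htJ, by linarith, by linarith⟩
    have hTmeas : MeasurableSet (T n) := by
      have hm : Measurable fun t => |θ x - θ t| :=
        (continuous_const.sub h.continuous_logRatio).abs.measurable
      exact hJ.measurableSet.inter ((measurableSet_le measurable_const hm).inter
        (measurableSet_le hm measurable_const))
    have hpow : Real.exp (-(1 / 16)) ^ n = Real.exp (-(n / 8) / 2) := by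
      rw [← Real.exp_nat_mul]; ring_nf
    calc ∫⁻ t in T n, ENNReal.ofReal (dampedWeight u v x t)
        ≤ ∫⁻ t in T n, ENNReal.ofReal (Real.exp (-(1 / 16)) ^ n) * ENNReal.ofReal (u t * v t) := by
          refine setLIntegral_mono' hTmeas fun t ht => ?_
          rw [← ENNReal.ofReal_mul (by positivity), hpow, mul_comm]
          refine ENNReal.ofReal_le_ofReal (mul_le_mul_of_nonneg_left ?_
            (mul_pos (h.u_pos t) (h.v_pos t)).le)
          exact Real.exp_le_exp.2 (by linarith [ht.2.1])
      _ = ENNReal.ofReal (Real.exp (-(1 / 16)) ^ n) * ∫⁻ t in T n, ENNReal.ofReal (u t * v t) :=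
          lintegral_const_mul _ (h.continuous_u.mul h.continuous_v).measurable.ennreal_ofReal
      _ ≤ ENNReal.ofReal (Real.exp (-(1 / 16)) ^ n) *
            (ENNReal.ofReal (8 * A) + ENNReal.ofReal (8 * A)) := by
          gcongr
          exact (lintegral_mono_set hTsub).trans
            ((lintegral_union_le _ _ _).trans (add_le_add (hS _) (hS _)))
      _ = _ := by
          rw [← ENNReal.ofReal_add (by positivity) (by positivity),
            ← ENNReal.ofReal_mul (by positivity)]
          ring_nf
  have hr1 : Real.exp (-(1 / 16)) < 1 := Real.exp_lt_one_iff.2 (by norm_num)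
  have hsum := summable_geometric_of_lt_one (Real.exp_pos (-(1 / 16))).le hr1
  calc ∫⁻ t in J, ENNReal.ofReal (dampedWeight u v x t)
      ≤ ∫⁻ t in ⋃ n, T n, ENNReal.ofReal (dampedWeight u v x t) := lintegral_mono_set hcover
    _ ≤ ∑' n, ∫⁻ t in T n, ENNReal.ofReal (dampedWeight u v x t) := lintegral_iUnion_le _ _
    _ ≤ ∑' n : ℕ, ENNReal.ofReal (16 * A * Real.exp (-(1 / 16)) ^ n) :=
        ENNReal.tsum_le_tsum hTn
    _ = _ := by
        rw [← ENNReal.ofReal_tsum_of_nonneg (fun n => by positivity) (hsum.mul_left _),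
          tsum_mul_left, tsum_geometric_of_lt_one (Real.exp_pos _).le hr1]

end GreenPair

namespace PFSS

variable {r q u v u' v' d₁ d₂ d : ℝ → ℝ}

theorem tendsto_logRatio_atTop (hp : PFSS r q u v u' v') :
    Tendsto (logRatio u v) atTop atTop := by
  have h : Tendsto (fun x => u x / v x) atTop (𝓝[>] 0) :=
    tendsto_nhdsWithin_iff.2 ⟨hp.ratio_top,
      Eventually.of_forall fun x => div_pos (hp.u_pos x) (hp.v_pos x)⟩
  refine (tendsto_neg_atBot_atTop.comp (Real.tendsto_log_nhdsGT_zero.comp h)).congr fun x => ?_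
  simp [logRatio, Real.log_div (hp.u_pos x).ne' (hp.v_pos x).ne']

theorem tendsto_logRatio_atBot (hp : PFSS r q u v u' v') :
    Tendsto (logRatio u v) atBot atBot := by
  have h : Tendsto (fun x => v x / u x) atBot (𝓝[>] 0) :=
    tendsto_nhdsWithin_iff.2 ⟨hp.ratio_bot,
      Eventually.of_forall fun x => div_pos (hp.v_pos x) (hp.u_pos x)⟩
  refine (Real.tendsto_log_nhdsGT_zero.comp h).congr fun x => ?_
  simp [logRatio, Real.log_div (hp.v_pos x).ne' (hp.u_pos x).ne']

theorem intervalIntegrable_one_div_hF (hd : IsD r (hF r d₁ d₂) d) (x : ℝ) :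
    IntervalIntegrable (fun t => 1 / (r t * hF r d₁ d₂ t)) volume (x - d x) (x + d x) := by
  by_contra hn
  have := (hd x).2
  rw [intervalIntegral.integral_undef hn] at this
  exact zero_ne_one this

theorem integral_one_div_le_two (hp : PFSS r q u v u' v') (hc : Cond12 r q) (h₁ : IsD1 r q d₁)
    (h₂ : IsD2 r q d₂) (hd : IsD r (hF r d₁ d₂) d) (x : ℝ) :
    ∫ t in x - d x..x + d x, 1 / (r t * (u t * v t)) ≤ 2 := by
  have hdx := (hd x).1
  calc ∫ t in x - d x..x + d x, 1 / (r t * (u t * v t))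
      ≤ ∫ t in x - d x..x + d x, 2 * (1 / (r t * hF r d₁ d₂ t)) := by
        refine intervalIntegral.integral_mono_on (by linarith)
          (hp.intervalIntegrable_one_div hc _ _)
          ((intervalIntegrable_one_div_hF hd x).const_mul 2) fun t _ => ?_
        have hr := hc.2.2.1 t
        have hh := hF_pos hc h₁ h₂ t
        have huv := mul_pos (hp.u_pos t) (hp.v_pos t)
        have := (hp.hF_le_and_le_hF hc h₁ h₂ t).1
        rw [mul_one_div, div_le_div_iff₀ (by positivity) (by positivity)]
        nlinarith
    _ = 2 := by rw [intervalIntegral.integral_const_mul, (hd x).2, mul_one]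

theorem half_length_le (hp : PFSS r q u v u' v') (hc : Cond12 r q) (h₁ : IsD1 r q d₁)
    (h₂ : IsD2 r q d₂) (hd : IsD r (hF r d₁ d₂) d) {a b : ℝ}
    (hθ : logRatio u v b - logRatio u v a ≤ 1 / 8) : (b - a) / 2 ≤ d ((a + b) / 2) := by
  by_contra! hlt
  set m := (a + b) / 2 with hm
  have hdm := (hd m).1
  have h78 : Real.exp (1 / 8) ≤ 8 / 7 := by
    have h1 := Real.add_one_le_exp (-(1 / 8) : ℝ)
    rw [Real.exp_neg] at h1
    have h2 := (le_inv_comm₀ (by norm_num) (Real.exp_pos _)).1 h1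
    norm_num at h2 ⊢
    linarith
  have hmono := hp.greenPair.monotone_logRatio
  have hle : m - d m ≤ m + d m := by linarith
  have hθ' : Real.exp (logRatio u v (m + d m) - logRatio u v (m - d m)) ≤ 8 / 7 := by
    refine (Real.exp_le_exp.2 ?_).trans h78
    have e1 : logRatio u v (m + d m) ≤ logRatio u v b := hmono (by linarith)
    have e2 : logRatio u v a ≤ logRatio u v (m - d m) := hmono (by linarith)
    linarith
  have hv := hp.greenPair.v_le_mul_exp hle
  have hu := hp.greenPair.u_le_mul_exp hle
  have hv' : (v (m + d m) - v (m - d m)) / v (m - d m) ≤ 1 / 7 := by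
    rw [div_le_iff₀ (hp.v_pos _)]
    nlinarith [hp.v_pos (m - d m)]
  have hu' : (u (m - d m) - u (m + d m)) / u (m + d m) ≤ 1 / 7 := by
    rw [div_le_iff₀ (hp.u_pos _)]
    nlinarith [hp.u_pos (m + d m)]
  have hbound := hp.integral_one_div_le hc hle
  have hle2 : ∫ t in m - d m..m + d m, 1 / (r t * hF r d₁ d₂ t) ≤
      ∫ t in m - d m..m + d m, 2 * (1 / (r t * (u t * v t))) := by
    refine intervalIntegral.integral_mono_on hle (intervalIntegrable_one_div_hF hd m)
      ((hp.intervalIntegrable_one_div hc _ _).const_mul 2) fun t _ => ?_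
    have hr := hc.2.2.1 t
    have hh := hF_pos hc h₁ h₂ t
    have huv := mul_pos (hp.u_pos t) (hp.v_pos t)
    have := (hp.hF_le_and_le_hF hc h₁ h₂ t).2
    rw [mul_one_div, div_le_div_iff₀ (by positivity) (by positivity)]
    nlinarith
  rw [(hd m).2, intervalIntegral.integral_const_mul] at hle2
  linarith

theorem setLIntegral_Icc_le (hp : PFSS r q u v u' v') (hc : Cond12 r q) (h₁ : IsD1 r q d₁)
    (h₂ : IsD2 r q d₂) (hd : IsD r (hF r d₁ d₂) d) (a b : ℝ) (hab : a ≤ b)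
    (hθ : logRatio u v b - logRatio u v a ≤ 1 / 8) :
    ∫⁻ t in Set.Icc a b, ENNReal.ofReal (u t * v t) ≤
      ENNReal.ofReal (8 * (hF r d₁ d₂ ((a + b) / 2) * d ((a + b) / 2))) := by
  have hlen := hp.half_length_le hc h₁ h₂ hd hθ
  set m := (a + b) / 2 with hm
  have hmono := hp.greenPair.monotone_logRatio
  have hh := (hp.hF_le_and_le_hF hc h₁ h₂ m).2
  have hexp : Real.exp (1 / 8) ≤ 2 := by
    have h1 := Real.add_one_le_exp (-(1 / 8) : ℝ)
    rw [Real.exp_neg] at h1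
    have h2 := (le_inv_comm₀ (by norm_num) (Real.exp_pos _)).1 h1
    norm_num at h2 ⊢
    linarith
  calc ∫⁻ t in Set.Icc a b, ENNReal.ofReal (u t * v t)
      ≤ ∫⁻ _ in Set.Icc a b, ENNReal.ofReal (4 * hF r d₁ d₂ m) := by
        refine setLIntegral_mono' measurableSet_Icc fun t ht => ENNReal.ofReal_le_ofReal ?_
        have hρ := hp.greenPair.mul_le_mul_exp m t
        have hab' : |logRatio u v m - logRatio u v t| ≤ 1 / 8 := by
          have e1 : logRatio u v m ≤ logRatio u v b := hmono (by linarith)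
          have e2 : logRatio u v a ≤ logRatio u v m := hmono (by linarith)
          have e3 := hmono ht.1
          have e4 := hmono ht.2
          exact abs_le.2 ⟨by linarith, by linarith⟩
        have := (Real.exp_le_exp.2 hab').trans hexp
        nlinarith [mul_pos (hp.u_pos m) (hp.v_pos m)]
    _ = ENNReal.ofReal (4 * hF r d₁ d₂ m * (b - a)) := by
        rw [setLIntegral_const, Real.volume_Icc, ← ENNReal.ofReal_mul
          (by linarith [hF_pos hc h₁ h₂ m])]
    _ ≤ _ := ENNReal.ofReal_le_ofReal (by nlinarith [hF_pos hc h₁ h₂ m])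

theorem bddAbove_range (hp : PFSS r q u v u' v') (hc : Cond12 r q) (h₁ : IsD1 r q d₁)
    (h₂ : IsD2 r q d₂) (hd : IsD r (hF r d₁ d₂) d)
    (hlim : Tendsto (fun x => hF r d₁ d₂ x * d x) (cocompact ℝ) (𝓝 0)) :
    BddAbove (Set.range fun x => hF r d₁ d₂ x * d x) := by
  have hev := hlim.eventually (gt_mem_nhds one_pos)
  rw [Filter.Eventually, mem_cocompact] at hev
  obtain ⟨K, hK, hKsub⟩ := hev
  obtain ⟨R, hR⟩ := hK.isBounded.subset_closedBall 0
  obtain ⟨P, hP⟩ := (isCompact_closedBall (0 : ℝ) R).bddAbove_image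
    (hp.continuous_u.mul hp.continuous_v).continuousOn
  obtain ⟨M, hM⟩ := ((hp.tendsto_logRatio_atTop).eventually_gt_atTop
    (logRatio u v R + Real.log 1024)).exists_forall_of_atTop
  refine ⟨max 1 (2 * P * (M + R)), ?_⟩
  rintro _ ⟨x, rfl⟩
  by_cases hx : x ∈ K
  · refine le_max_of_le_right ?_
    have hxR := hR hx
    have hP' : u x * v x ≤ P := hP ⟨x, hxR, rfl⟩
    rw [Metric.mem_closedBall, dist_zero_right, Real.norm_eq_abs, abs_le] at hxR
    have hdx := (hd x).1
    have hh := (hp.hF_le_and_le_hF hc h₁ h₂ x).1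
    obtain ⟨e1, e2⟩ := hp.lt_of_integral_one_div_le_two hc (by linarith)
      (hp.integral_one_div_le_two hc h₁ h₂ hd x)
    have hxM : x + d x ≤ M := by
      by_contra! hlt
      have h3 := hM _ hlt.le
      have h4 : logRatio u v (x - d x) ≤ logRatio u v R :=
        hp.greenPair.monotone_logRatio (by linarith)
      have h5 := Real.log_le_log (hp.v_pos _) e1.le
      have h6 := Real.log_le_log (hp.u_pos _) e2.le
      rw [Real.log_mul (by norm_num) (hp.v_pos _).ne'] at h5
      rw [Real.log_mul (by norm_num) (hp.u_pos _).ne'] at h6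
      have h7 : Real.log 1024 = Real.log 32 + Real.log 32 := by
        rw [← Real.log_mul (by norm_num) (by norm_num)]; norm_num
      unfold logRatio at *
      linarith
    have hh0 := hF_pos hc h₁ h₂ x
    calc hF r d₁ d₂ x * d x ≤ (2 * P) * (M + R) := by
          refine mul_le_mul (by linarith) (by linarith) hdx.le ?_
          linarith [hF_pos hc h₁ h₂ x]
      _ = _ := by ring
  · exact le_max_of_le_left (hKsub hx).le

end PFSS

/-- An operator with kernel `U x * V t`, where `U` and `V` are square integrable, is compact. -/
theorem exists_isCompactOperator_mul {U V : ℝ → ℝ} (hU : MemLp U 2 volume)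
    (hV : MemLp V 2 volume) :
    ∃ S : LpR 2 →L[ℝ] LpR 2, IsCompactOperator S ∧
      ∀ f : LpR 2, S f =ᵐ[volume] fun x => ∫ t, U x * V t * f t := by
  refine ⟨(ContinuousLinearMap.toSpanSingleton ℝ (hU.toLp U)).comp (innerSL ℝ (hV.toLp V)),
    (isCompactOperator_of_locallyCompactSpace_rng
      (ContinuousLinearMap.toSpanSingleton ℝ (hU.toLp U))).comp_clm _,
    fun f => ?_⟩
  rw [ContinuousLinearMap.comp_apply, ContinuousLinearMap.toSpanSingleton_apply, innerSL_apply_apply]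
  have hinner : ⟪hV.toLp V, f⟫ = ∫ t, V t * f t := by
    rw [L2.inner_def]
    refine integral_congr_ae ?_
    filter_upwards [hV.coeFn_toLp] with t ht
    simp [ht, mul_comm]
  filter_upwards [Lp.coeFn_smul ⟪hV.toLp V, f⟫ (hU.toLp U), hU.coeFn_toLp] with x h1 h2
  rw [h1, Pi.smul_apply, h2, hinner, smul_eq_mul, mul_comm, ← integral_const_mul]
  simp_rw [mul_assoc]

namespace GreenPair

variable {u v η : ℝ → ℝ} {C : ℝ} {k : ℝ → ℤ}

theorem integrable_dampedWeight (h : GreenPair u v)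
    (hb : ∀ x, ∫⁻ t, ENNReal.ofReal (dampedWeight u v x t) ≤ ENNReal.ofReal C) (x : ℝ) :
    Integrable (dampedWeight u v x) volume :=
  (lintegral_ofReal_ne_top_iff_integrable (h.continuous_dampedWeight x).aestronglyMeasurable
    (Eventually.of_forall (h.dampedWeight_nonneg x))).1
    ((hb x).trans_lt ENNReal.ofReal_lt_top).ne

theorem memLp_indicator_v (h : GreenPair u v)
    (hb : ∀ x, ∫⁻ t, ENNReal.ofReal (dampedWeight u v x t) ≤ ENNReal.ofReal C) {S : Set ℝ}
    (hS : MeasurableSet S) {c : ℝ} (hSc : S ⊆ Set.Iic c) : MemLp (S.indicator v) 2 volume := by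
  have hm : AEStronglyMeasurable (S.indicator v) volume :=
    h.continuous_v.aestronglyMeasurable.indicator hS
  rw [memLp_two_iff_integrable_sq hm]
  refine ((h.integrable_dampedWeight hb c).const_mul (Real.exp (logRatio u v c))).mono'
    (hm.pow 2) (Eventually.of_forall fun t => ?_)
  have h0 := mul_nonneg (Real.exp_pos (logRatio u v c)).le (h.dampedWeight_nonneg c t)
  by_cases ht : t ∈ S
  · have hθ := h.monotone_logRatio (hSc ht)
    have hv : v t ^ 2 = u t * v t * Real.exp (logRatio u v t) := by
      have := (h.u_pos t).ne'
      rw [h.exp_logRatio]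
      field_simp
    rw [Set.indicator_of_mem ht, Real.norm_eq_abs, abs_of_nonneg (sq_nonneg _), hv, dampedWeight,
      abs_of_nonneg (sub_nonneg.2 hθ), mul_left_comm, ← Real.exp_add]
    refine mul_le_mul_of_nonneg_left (Real.exp_le_exp.2 ?_) (mul_pos (h.u_pos t) (h.v_pos t)).le
    linarith
  · simpa [Set.indicator_of_notMem ht] using h0

theorem memLp_indicator_u (h : GreenPair u v)
    (hb : ∀ x, ∫⁻ t, ENNReal.ofReal (dampedWeight u v x t) ≤ ENNReal.ofReal C) {S : Set ℝ}
    (hS : MeasurableSet S) {c : ℝ} (hSc : S ⊆ Set.Ici c) : MemLp (S.indicator u) 2 volume := by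
  have hm : AEStronglyMeasurable (S.indicator u) volume :=
    h.continuous_u.aestronglyMeasurable.indicator hS
  rw [memLp_two_iff_integrable_sq hm]
  refine ((h.integrable_dampedWeight hb c).const_mul (Real.exp (-logRatio u v c))).mono'
    (hm.pow 2) (Eventually.of_forall fun t => ?_)
  have h0 := mul_nonneg (Real.exp_pos (-logRatio u v c)).le (h.dampedWeight_nonneg c t)
  by_cases ht : t ∈ S
  · have hθ := h.monotone_logRatio (hSc ht)
    have hu : u t ^ 2 = u t * v t * Real.exp (-logRatio u v t) := by
      have := (h.v_pos t).ne'
      rw [Real.exp_neg, h.exp_logRatio, inv_div]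
      field_simp
    rw [Set.indicator_of_mem ht, Real.norm_eq_abs, abs_of_nonneg (sq_nonneg _), hu, dampedWeight,
      abs_of_nonpos (sub_nonpos.2 hθ), mul_left_comm, ← Real.exp_add]
    refine mul_le_mul_of_nonneg_left (Real.exp_le_exp.2 ?_) (mul_pos (h.u_pos t) (h.v_pos t)).le
    linarith
  · simpa [Set.indicator_of_notMem ht] using h0

/-- The restriction of the Green kernel to an off-diagonal block is of rank at most one. -/
theorem exists_isCompactOperator_offDiag (h : GreenPair u v)
    (hb : ∀ x, ∫⁻ t, ENNReal.ofReal (dampedWeight u v x t) ≤ ENNReal.ofReal C) (hk : Monotone k)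
    {i j : ℤ} (hij : i ≠ j) :
    ∃ S : LpR 2 →L[ℝ] LpR 2, IsCompactOperator S ∧ ∀ f : LpR 2, S f =ᵐ[volume] fun x =>
      ∫ t, (if k x = i ∧ k t = j then greenKernel u v x t else 0) * f t := by
  have hlt {x t : ℝ} (hxt : k x < k t) : x < t := lt_of_not_ge fun hle => (hk hle).not_gt hxt
  by_cases hne : (∃ x, k x = i) ∧ ∃ t, k t = j
  · obtain ⟨⟨a, rfl⟩, b, rfl⟩ := hne
    have hma : MeasurableSet {x | k x = k a} := hk.measurable (measurableSet_singleton _)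
    have hmb : MeasurableSet {x | k x = k b} := hk.measurable (measurableSet_singleton _)
    have hmem {c x : ℝ} : x ∈ {x | k x = k c} ↔ k x = k c := Iff.rfl
    rcases lt_or_gt_of_ne hij with hab | hab
    · obtain ⟨S, hS, hSf⟩ := exists_isCompactOperator_mul
        (h.memLp_indicator_v hb hma (c := b) fun x hx => (hlt (hmem.1 hx ▸ hab)).le)
        (h.memLp_indicator_u hb hmb (c := a) fun x hx => (hlt (hmem.1 hx ▸ hab)).le)
      refine ⟨S, hS, fun f => (hSf f).trans (Eventually.of_forall fun x => ?_)⟩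
      refine integral_congr_ae (Eventually.of_forall fun t => ?_)
      simp only [Set.indicator_apply, hmem]
      by_cases h1 : k x = k a <;> by_cases h2 : k t = k b
      · have hxt : x < t := hlt (by omega)
        simp [h1, h2, greenKernel, hxt.not_ge, mul_comm]
      all_goals simp [h1, h2]
    · obtain ⟨S, hS, hSf⟩ := exists_isCompactOperator_mul
        (h.memLp_indicator_u hb hma (c := b) fun x hx => (hlt (hmem.1 hx ▸ hab)).le)
        (h.memLp_indicator_v hb hmb (c := a) fun x hx => (hlt (hmem.1 hx ▸ hab)).le)
      refine ⟨S, hS, fun f => (hSf f).trans (Eventually.of_forall fun x => ?_)⟩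
      refine integral_congr_ae (Eventually.of_forall fun t => ?_)
      simp only [Set.indicator_apply, hmem]
      by_cases h1 : k x = k a <;> by_cases h2 : k t = k b
      · have hxt : t < x := hlt (by omega)
        simp [h1, h2, greenKernel, hxt.le]
      all_goals simp [h1, h2]
  · refine ⟨0, isCompactOperator_zero, fun f => ?_⟩
    rw [zero_apply]
    refine (Lp.coeFn_zero ℝ 2 volume).trans (Eventually.of_forall fun x => ?_)
    have (t : ℝ) : ¬(k x = i ∧ k t = j) := fun hh => hne ⟨⟨x, hh.1⟩, t, hh.2⟩
    simp [this]

/-- The Green operator differs from a block diagonal one by an operator of finite rank. -/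
theorem exists_isCompactOperator_norm_sub_le (h : GreenPair u v)
    (hb : ∀ x, ∫⁻ t, ENNReal.ofReal (dampedWeight u v x t) ≤ ENNReal.ofReal C) (hk : Monotone k)
    {s : Finset ℤ} (hs : ∀ x, k x ∈ s) {w w' : ℝ → ℝ} {C' C'' : ℝ}
    (hG : SchurKernel volume (greenKernel u v) w C')
    (hB : SchurKernel volume (blockKernel k u v) w' C'') :
    ∃ S : LpR 2 →L[ℝ] LpR 2, IsCompactOperator S ∧ ‖hG.toCLM - S‖ ≤ C'' := by
  have hex (p : ℤ × ℤ) : ∃ S : LpR 2 →L[ℝ] LpR 2, IsCompactOperator S ∧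
      (p.1 ≠ p.2 → ∀ f : LpR 2, S f =ᵐ[volume] fun x =>
        ∫ t, (if k x = p.1 ∧ k t = p.2 then greenKernel u v x t else 0) * f t) := by
    by_cases hp : p.1 = p.2
    · exact ⟨0, isCompactOperator_zero, fun hne => absurd hp hne⟩
    · obtain ⟨S, hS, hSf⟩ := h.exists_isCompactOperator_offDiag hb hk hp
      exact ⟨S, hS, fun _ => hSf⟩
  choose S hS hSf using hex
  have hcomp : (∑ p ∈ s.offDiag, S p) ∈
      compactOperator (RingHom.id ℝ) (LpR 2) (LpR 2) := Submodule.sum_mem _ fun p _ => hS p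
  refine ⟨∑ p ∈ s.offDiag, S p, hcomp, ?_⟩
  have hdiff : hG.toCLM - ∑ p ∈ s.offDiag, S p = hB.toCLM := by
    refine ContinuousLinearMap.ext fun f => Lp.ext ?_
    rw [sub_apply, sum_apply]
    have hall : ∀ᵐ x, ∀ p ∈ s.offDiag, S p f x =
        ∫ t, (if k x = p.1 ∧ k t = p.2 then greenKernel u v x t else 0) * f t := by
      rw [Finset.eventually_all]
      exact fun p hp => hSf p (Finset.mem_offDiag.1 hp).2.2 f
    filter_upwards [Lp.coeFn_sub (hG.toCLM f) (∑ p ∈ s.offDiag, S p f),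
      Lp.coeFn_fun_finsetSum s.offDiag fun p => S p f, hall, hG.toCLM_ae_eq f, hB.toCLM_ae_eq f,
      hG.ae_integrable f] with x h1 h2 h3 h4 h5 hint
    have hpiece (p : ℤ × ℤ) : Integrable
        (fun t => (if k x = p.1 ∧ k t = p.2 then greenKernel u v x t else 0) * f t) := by
      have hm : MeasurableSet {t | k x = p.1 ∧ k t = p.2} :=
        (MeasurableSet.const _).inter (hk.measurable (measurableSet_singleton p.2))
      refine (hint.indicator hm).congr (Eventually.of_forall fun t => ?_)
      by_cases ht : k x = p.1 ∧ k t = p.2 <;> simp [ht]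
    rw [h1, Pi.sub_apply, h2, Finset.sum_congr rfl h3, h4, h5,
      ← integral_finsetSum _ fun p _ => hpiece p,
      ← integral_sub hint (integrable_finsetSum _ fun p _ => hpiece p)]
    refine integral_congr_ae (Eventually.of_forall fun t => ?_)
    simp only [blockKernel, ← Finset.sum_mul, ← sub_mul]
    congr 1
    by_cases hxt : k x = k t
    · rw [if_pos hxt, Finset.sum_eq_zero, sub_zero]
      rintro p hp
      refine if_neg fun hh => (Finset.mem_offDiag.1 hp).2.2 ?_
      rw [← hh.1, ← hh.2, hxt]
    · rw [if_neg hxt, Finset.sum_eq_single (k x, k t), if_pos ⟨rfl, rfl⟩, sub_self]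
      · exact fun p _ hp => if_neg fun hh => hp (Prod.ext hh.1.symm hh.2.symm)
      · exact fun hn => absurd (Finset.mem_offDiag.2 ⟨hs x, hs t, hxt⟩) hn
  rw [hdiff]
  exact hB.norm_toCLM_le

/-- If the damped mass near infinity is small, the line splits into finitely many blocks each of
which carries small damped mass. -/
theorem exists_monotone_setLIntegral_le (h : GreenPair u v) {δ : ℝ} (hδ : 0 < δ) (R : ℕ)
    (htop : ∀ x, ∫⁻ t in Set.Ici (R : ℝ), ENNReal.ofReal (dampedWeight u v x t) ≤
      ENNReal.ofReal δ)
    (hbot : ∀ x, ∫⁻ t in Set.Iic (-(R : ℝ)), ENNReal.ofReal (dampedWeight u v x t) ≤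
      ENNReal.ofReal δ) :
    ∃ (k : ℝ → ℤ) (s : Finset ℤ), Monotone k ∧ (∀ x, k x ∈ s) ∧
      ∀ x, ∫⁻ t in {t | k t = k x}, ENNReal.ofReal (dampedWeight u v x t) ≤ ENNReal.ofReal δ := by
  obtain ⟨P, hP⟩ := (isCompact_Icc (a := -(R : ℝ) - 1) (b := R + 1)).bddAbove_image
    (h.continuous_u.mul h.continuous_v).continuousOn
  obtain ⟨m, hm⟩ := exists_nat_gt (P / δ)
  obtain ⟨n, hn1, hn⟩ : ∃ n : ℕ, (1 : ℝ) ≤ n ∧ P / δ ≤ n :=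
    ⟨m + 1, by push_cast; linarith [m.cast_nonneg (α := ℝ)], by push_cast; linarith⟩
  have hn0 : (0 : ℝ) < n := by linarith
  set N : ℤ := n * R + 1 with hN
  have hNR : (N : ℝ) = n * R + 1 := by rw [hN]; push_cast; ring
  have hN0 : 0 < N := by positivity
  set k : ℝ → ℤ := fun x => max (-N) (min N ⌊n * x⌋) with hkdef
  have hfl (t : ℝ) := Int.floor_le (n * t)
  have hfl' (t : ℝ) := Int.lt_floor_add_one (n * t)
  refine ⟨k, Finset.Icc (-N) N, fun x y hxy => ?_, fun x => ?_, fun x => ?_⟩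
  · have := Int.floor_mono (mul_le_mul_of_nonneg_left hxy hn0.le)
    simp only [hkdef]
    omega
  · rw [Finset.mem_Icc]
    simp only [hkdef]
    omega
  by_cases hx1 : k x = N
  · refine (lintegral_mono_set fun t (ht : k t = k x) => ?_).trans (htop x)
    have hf : N ≤ ⌊n * t⌋ := by
      rw [hx1] at ht
      simp only [hkdef] at ht
      omega
    have hf' : (N : ℝ) ≤ ⌊n * t⌋ := by exact_mod_cast hf
    have := hfl t
    exact le_of_mul_le_mul_left (by linarith : (n : ℝ) * R ≤ n * t) hn0
  by_cases hx2 : k x = -N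
  · refine (lintegral_mono_set fun t (ht : k t = k x) => ?_).trans (hbot x)
    have hf : ⌊n * t⌋ ≤ -N := by
      rw [hx2] at ht
      simp only [hkdef] at ht
      omega
    have hf' : (⌊n * t⌋ : ℝ) ≤ -N := by exact_mod_cast hf
    have := hfl' t
    exact le_of_mul_le_mul_left (by linarith : (n : ℝ) * t ≤ n * (-R)) hn0
  have hkx : -N < k x ∧ k x < N := by
    simp only [hkdef] at *
    omega
  have h1 : -(N : ℝ) + 1 ≤ k x := by exact_mod_cast hkx.1
  have h2 : (k x : ℝ) + 1 ≤ N := by exact_mod_cast hkx.2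
  have hsub : {t | k t = k x} ⊆ Set.Icc ((k x : ℝ) / n) ((k x + 1) / n) := by
    intro t (ht : k t = k x)
    have hf : ⌊n * t⌋ = k x := by
      have := hkx
      rw [← ht] at this ⊢
      simp only [hkdef] at this ⊢
      omega
    have h3 := hfl t
    have h4 := hfl' t
    rw [hf] at h3 h4
    rw [Set.mem_Icc, div_le_iff₀ hn0, le_div_iff₀ hn0]
    constructor <;> linarith
  have hP0 : 0 ≤ P := (mul_pos (h.u_pos 0) (h.v_pos 0)).le.trans
    (hP ⟨0, ⟨by linarith [R.cast_nonneg (α := ℝ)], by linarith [R.cast_nonneg (α := ℝ)]⟩, rfl⟩)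
  calc ∫⁻ t in {t | k t = k x}, ENNReal.ofReal (dampedWeight u v x t)
      ≤ ∫⁻ t in Set.Icc ((k x : ℝ) / n) ((k x + 1) / n),
          ENNReal.ofReal (dampedWeight u v x t) := lintegral_mono_set hsub
    _ ≤ ∫⁻ _ in Set.Icc ((k x : ℝ) / n) ((k x + 1) / n), ENNReal.ofReal P := by
        refine setLIntegral_mono' measurableSet_Icc fun t ht => ENNReal.ofReal_le_ofReal ?_
        refine (h.dampedWeight_le x t).trans (hP ⟨t, ?_, rfl⟩)
        rw [Set.mem_Icc, div_le_iff₀ hn0, le_div_iff₀ hn0] at ht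
        constructor <;> nlinarith
    _ = ENNReal.ofReal (P / n) := by
        rw [setLIntegral_const, Real.volume_Icc, ← ENNReal.ofReal_mul hP0]
        congr 1
        ring
    _ ≤ ENNReal.ofReal δ := by
        refine ENNReal.ofReal_le_ofReal ?_
        rwa [div_le_comm₀ hn0 hδ]

theorem isCompactOperator_toCLM (h : GreenPair u v)
    (hbot : Tendsto (logRatio u v) atBot atBot) (htop : Tendsto (logRatio u v) atTop atTop)
    (hη : ∀ a b, a ≤ b → logRatio u v b - logRatio u v a ≤ 1 / 8 →
      ∫⁻ t in Set.Icc a b, ENNReal.ofReal (u t * v t) ≤ ENNReal.ofReal (8 * η ((a + b) / 2)))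
    (hlim : Tendsto η (cocompact ℝ) (𝓝 0))
    (hb : ∀ x, ∫⁻ t, ENNReal.ofReal (dampedWeight u v x t) ≤ ENNReal.ofReal C)
    {w : ℝ → ℝ} {C' : ℝ} (hG : SchurKernel volume (greenKernel u v) w C') :
    IsCompactOperator hG.toCLM := by
  refine isCompactOperator_of_forall_exists_norm_sub_le fun ε hε => ?_
  have he : 0 < 1 - Real.exp (-(1 / 16)) :=
    sub_pos.2 (Real.exp_lt_one_iff.2 (by norm_num))
  set A : ℝ := ε * (1 - Real.exp (-(1 / 16))) / 16 with hA
  have hA0 : 0 < A := by positivity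
  have hAε : 16 * A * (1 - Real.exp (-(1 / 16)))⁻¹ = ε := by
    rw [hA]; field_simp
  have hev := hlim.eventually (gt_mem_nhds hA0)
  rw [Filter.Eventually, mem_cocompact] at hev
  obtain ⟨K, hK, hKsub⟩ := hev
  obtain ⟨R₀, hR₀⟩ := hK.isBounded.subset_closedBall 0
  obtain ⟨R, hR⟩ := exists_nat_gt R₀
  have hout (x : ℝ) (hx : (R : ℝ) ≤ |x|) : η x ≤ A := by
    by_contra! hlt
    have hxK : x ∈ K := by
      by_contra hn
      exact lt_asymm hlt (hKsub hn)
    have := hR₀ hxK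
    rw [Metric.mem_closedBall, dist_zero_right, Real.norm_eq_abs] at this
    linarith
  obtain ⟨k, s, hk, hs, hks⟩ := h.exists_monotone_setLIntegral_le hε R
    (fun x => (h.setLIntegral_dampedWeight_le hbot htop hη isClosed_Ici Set.ordConnected_Ici
      hA0.le (fun y hy => hout y (le_trans hy (le_abs_self y))) x).trans_eq (by rw [hAε]))
    (fun x => (h.setLIntegral_dampedWeight_le hbot htop hη isClosed_Iic Set.ordConnected_Iic
      hA0.le (fun y hy => hout y (le_trans (le_neg_of_le_neg hy) (neg_le_abs y))) x).trans_eq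
        (by rw [hAε]))
  exact h.exists_isCompactOperator_norm_sub_le hb hk hs hG
    (h.schurKernel_blockKernel hk.measurable hε.le hks)

end GreenPair

/-- The indicator of `[x - d x, x + d x]` as a test function bounds the norm of the Green
operator from below. -/
theorem PFSS.hF_mul_le_norm_toCLM {r q u v u' v' d₁ d₂ d : ℝ → ℝ} (hp : PFSS r q u v u' v')
    (hc : Cond12 r q) (h₁ : IsD1 r q d₁) (h₂ : IsD2 r q d₂) (hd : IsD r (hF r d₁ d₂) d)
    {w : ℝ → ℝ} {C : ℝ} (hG : SchurKernel volume (greenKernel u v) w C) (x : ℝ) :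
    hF r d₁ d₂ x * d x ≤ 1024 * ‖hG.toCLM‖ := by
  have hdx := (hd x).1
  set S := Set.Icc (x - d x) (x + d x) with hS
  have hSm : MeasurableSet S := measurableSet_Icc
  have hSfin : volume S ≠ ⊤ := measure_Icc_lt_top.ne
  have hSvol : volume.real S = 2 * d x := by
    rw [hS, Real.volume_real_Icc_of_le (by linarith)]
    ring
  set f : LpR 2 := indicatorConstLp 2 hSm hSfin (1 : ℝ) with hf
  have hnorm : ‖f‖ ^ 2 = 2 * d x := by
    rw [hf, norm_indicatorConstLp (by norm_num) (by norm_num), hSvol, norm_one, one_mul]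
    rw [← Real.rpow_natCast, ← Real.rpow_mul (by positivity)]
    norm_num
  set m := hF r d₁ d₂ x / 2048 with hm
  have hmpos : 0 < m := div_pos (hF_pos hc h₁ h₂ x) (by norm_num)
  obtain ⟨hv, hu⟩ := hp.lt_of_integral_one_div_le_two hc (by linarith)
    (hp.integral_one_div_le_two hc h₁ h₂ hd x)
  have hcmp {s t : ℝ} (hs : s ∈ S) (ht : t ∈ S) : m ≤ u s * v t := by
    have a1 : u x ≤ u (x - d x) := hp.antitone_u (by linarith)
    have a2 : u (x + d x) ≤ u s := hp.antitone_u hs.2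
    have b1 : v x ≤ v (x + d x) := hp.monotone_v (by linarith)
    have b2 : v (x - d x) ≤ v t := hp.monotone_v ht.1
    have hh := (hp.hF_le_and_le_hF hc h₁ h₂ x).1
    have := mul_le_mul (show u x ≤ 32 * u s by linarith) (show v x ≤ 32 * v t by linarith)
      (hp.v_pos x).le (by linarith [hp.u_pos s])
    rw [hm]
    linarith
  have hker {s t : ℝ} (hs : s ∈ S) (ht : t ∈ S) : m ≤ greenKernel u v s t := by
    unfold greenKernel
    split_ifs
    exacts [hcmp hs ht, hcmp ht hs]
  have hfae : f =ᵐ[volume] S.indicator fun _ => 1 := indicatorConstLp_coeFn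
  have hlow : m * (2 * d x) ^ 2 ≤ ⟪hG.toCLM f, f⟫ := by
    rw [hG.inner_toCLM]
    have hI : ∫ p : ℝ × ℝ, (S ×ˢ S).indicator (fun _ => m) p ∂(volume.prod volume) =
        m * (2 * d x) ^ 2 := by
      rw [integral_indicator_const _ (hSm.prod hSm), measureReal_prod_prod, hSvol, smul_eq_mul]
      ring
    rw [← hI]
    refine integral_mono_ae ((integrable_indicator_iff (hSm.prod hSm)).2 (integrableOn_const ?_))
      (hG.integrable_prod f f) ?_
    · rw [Measure.prod_prod]
      exact ENNReal.mul_ne_top hSfin hSfin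
    filter_upwards [Measure.quasiMeasurePreserving_fst.ae_eq hfae,
      Measure.quasiMeasurePreserving_snd.ae_eq hfae] with p h1 h2
    simp only [Function.comp_apply] at h1 h2
    simp only [h1, h2]
    by_cases hp1 : p.1 ∈ S <;> by_cases hp2 : p.2 ∈ S
    · rw [Set.indicator_of_mem (Set.mk_mem_prod hp1 hp2), Set.indicator_of_mem hp1,
        Set.indicator_of_mem hp2, mul_one, mul_one]
      exact hker hp1 hp2
    all_goals simp [hp1, hp2]
  have hup : ⟪hG.toCLM f, f⟫ ≤ ‖hG.toCLM‖ * (2 * d x) := by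
    rw [← hnorm, sq, ← mul_assoc]
    exact (real_inner_le_norm _ _).trans
      (mul_le_mul_of_nonneg_right (hG.toCLM.le_opNorm f) (norm_nonneg f))
  have : m * (2 * d x) ≤ ‖hG.toCLM‖ := by
    refine le_of_mul_le_mul_right ?_ (show 0 < 2 * d x by linarith)
    linarith
  rw [hm] at this
  linarith

/-- **Theorem 3.4.** There is a universal constant `c ≥ 1` such that whenever
(1.2), (1.3) hold, `u, v` is a principal FSS and `h(x)d(x) → 0` as `|x| → ∞`,
the Green operator on `L₂(ℝ)` exists (is bounded), is compact, self-adjoint and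
positive, and its maximal eigenvalue `λ` satisfies `c⁻¹ B ≤ λ ≤ c B` with
`B = sup_x h(x) d(x)`. -/
theorem green_L2_compact_selfadjoint_positive_maximal_eigenvalue :
    ∃ c : ℝ, 1 ≤ c ∧
      ∀ (r q u v u' v' d₁ d₂ d : ℝ → ℝ),
        Cond12 r q → Cond13 r q → PFSS r q u v u' v' →
        IsD1 r q d₁ → IsD2 r q d₂ → IsD r (hF r d₁ d₂) d →
        Tendsto (fun x => hF r d₁ d₂ x * d x) (cocompact ℝ) (𝓝 0) →
        ∃ G : LpR 2 →L[ℝ] LpR 2, IsGreenOp u v 2 G ∧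
          IsCompactOperator G ∧
          (∀ f g : LpR 2, ⟪G f, g⟫ = ⟪f, G g⟫) ∧
          (∀ f : LpR 2, 0 ≤ ⟪G f, f⟫) ∧
          ∃ lam : ℝ,
            Module.End.HasEigenvalue (G : LpR 2 →ₗ[ℝ] LpR 2) lam ∧
            (∀ μ : ℝ, Module.End.HasEigenvalue (G : LpR 2 →ₗ[ℝ] LpR 2) μ → μ ≤ lam) ∧
            c⁻¹ * (⨆ x : ℝ, hF r d₁ d₂ x * d x) ≤ lam ∧
            lam ≤ c * (⨆ x : ℝ, hF r d₁ d₂ x * d x) := by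
  have he : 0 < 1 - Real.exp (-(1 / 16)) :=
    sub_pos.2 (Real.exp_lt_one_iff.2 (by norm_num))
  set c₀ : ℝ := 16 * (1 - Real.exp (-(1 / 16)))⁻¹ with hc₀
  have hc₀pos : 0 < c₀ := by positivity
  refine ⟨max 1024 c₀, le_max_of_le_left (by norm_num), ?_⟩
  intro r q u v u' v' d₁ d₂ d hc _ hp h₁ h₂ hd hlim
  have hg := hp.greenPair
  have hbdd := hp.bddAbove_range hc h₁ h₂ hd hlim
  set B := ⨆ x : ℝ, hF r d₁ d₂ x * d x with hBdef
  have hle (x : ℝ) : hF r d₁ d₂ x * d x ≤ B := le_ciSup hbdd x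
  have hpos0 : 0 < hF r d₁ d₂ 0 * d 0 := mul_pos (hF_pos hc h₁ h₂ 0) (hd 0).1
  have hB : 0 < B := hpos0.trans_le (hle 0)
  have hη := hp.setLIntegral_Icc_le hc h₁ h₂ hd
  have hb (x : ℝ) : ∫⁻ t, ENNReal.ofReal (dampedWeight u v x t) ≤ ENNReal.ofReal (c₀ * B) := by
    have := hg.setLIntegral_dampedWeight_le hp.tendsto_logRatio_atBot hp.tendsto_logRatio_atTop
      (η := fun x => hF r d₁ d₂ x * d x) hη isClosed_univ Set.ordConnected_univ hB.le
      (fun x _ => hle x) x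
    rw [Measure.restrict_univ] at this
    exact this.trans_eq (by rw [hc₀]; ring_nf)
  have hG := hg.schurKernel_greenKernel (mul_pos hc₀pos hB).le hb
  have hcompact : IsCompactOperator hG.toCLM := hg.isCompactOperator_toCLM
    hp.tendsto_logRatio_atBot hp.tendsto_logRatio_atTop hη hlim hb hG
  have hnonneg (f : LpR 2) : 0 ≤ ⟪hG.toCLM f, f⟫ := by
    rw [hG.inner_toCLM]
    exact hg.integral_greenKernel_nonneg (Lp.aestronglyMeasurable f) (hG.integrable_prod f f)
  have hlow := hp.hF_mul_le_norm_toCLM hc h₁ h₂ hd hG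
  have hne : hG.toCLM ≠ 0 := by
    intro h0
    have := hlow 0
    rw [h0, norm_zero] at this
    linarith
  obtain ⟨heig, hmax⟩ := exists_maximal_eigenvalue_eq_norm hcompact hG.toCLM_symmetric hnonneg hne
  refine ⟨hG.toCLM, hG.toCLM_ae_eq, hcompact, hG.toCLM_symmetric, hnonneg, ‖hG.toCLM‖, heig,
    hmax, ?_, ?_⟩
  · rw [inv_mul_le_iff₀ (lt_max_of_lt_left (by norm_num))]
    exact ciSup_le fun x => (hlow x).trans
      (mul_le_mul_of_nonneg_right (le_max_left _ _) (norm_nonneg _))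
  · exact hG.norm_toCLM_le.trans (mul_le_mul_of_nonneg_right (le_max_right _ _) hB.le)
end
end

section
/- Assume conditions (1.2) and (2.1), let u, v be a principal fundamental system of solutions of (r z')' = q z with ρ = u·v, and let p ∈ (1,∞). Then the Green operator G is a bounded operator on L_p(ℝ) (equivalently, the equation −(r y')' + q y = f is correctly solvable in L_p(ℝ)) if and only if S := sup_{x∈ℝ} ρ(x) s(x) < ∞. -/
open MeasureTheory Filter Topology
open scoped ENNReal RealInnerProductSpace

noncomputable section

/-- Schur test for a kernel dominated by `ρ(x)^{1/p} ρ(t)^{1/q} E(x,t)` with `E` symmetric. -/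
theorem lintegral_rpow_lintegral_mul_le {α : Type*} [MeasurableSpace α] {μ : Measure α} [SFinite μ]
    {p q : ℝ} (hpq : p.HolderConjugate q) {K E : α → α → ℝ≥0∞} {ρ g : α → ℝ≥0∞} {C : ℝ≥0∞}
    (hE : Measurable (Function.uncurry E)) (hρ : Measurable ρ) (hg : Measurable g)
    (hsymm : ∀ x t, E x t = E t x)
    (hK : ∀ x t, K x t ≤ ρ x ^ (1 / p) * (ρ t ^ (1 / q) * E x t))
    (hC : ∀ x, ∫⁻ t, ρ t * E x t ∂μ ≤ C) :
    ∫⁻ x, (∫⁻ t, K x t * g t ∂μ) ^ p ∂μ ≤ C ^ (p / q) * C * ∫⁻ t, g t ^ p ∂μ := by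
  have hp := hpq.pos
  have hq := hpq.symm.pos
  have hEx : ∀ x, Measurable (E x) := fun x => hE.comp measurable_prodMk_left
  have hsum : 1 / q + 1 / p = 1 := by simpa using hpq.symm.inv_add_inv_eq_one
  have hpoint : ∀ x, (∫⁻ t, K x t * g t ∂μ) ^ p
      ≤ C ^ (p / q) * (ρ x * ∫⁻ t, E x t * g t ^ p ∂μ) := by
    intro x
    have h1 : ∫⁻ t, K x t * g t ∂μ ≤
        ρ x ^ (1 / p) * (C ^ (1 / q) * (∫⁻ t, E x t * g t ^ p ∂μ) ^ (1 / p)) := by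
      calc ∫⁻ t, K x t * g t ∂μ
          ≤ ∫⁻ t, ρ x ^ (1 / p) *
              ((fun t => (ρ t * E x t) ^ (1 / q)) * fun t => E x t ^ (1 / p) * g t) t ∂μ := by
            refine lintegral_mono fun t => ?_
            have h2 : E x t = E x t ^ (1 / q) * E x t ^ (1 / p) := by
              rw [← ENNReal.rpow_add_of_nonneg _ _ (by positivity) (by positivity), hsum,
                ENNReal.rpow_one]
            calc K x t * g t ≤ ρ x ^ (1 / p) * (ρ t ^ (1 / q) * E x t) * g t := by
                  gcongr; exact hK x t
              _ = ρ x ^ (1 / p) *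
                    (ρ t ^ (1 / q) * (E x t ^ (1 / q) * E x t ^ (1 / p))) * g t := by rw [← h2]
              _ = _ := by
                  simp only [Pi.mul_apply]
                  rw [ENNReal.mul_rpow_of_nonneg _ _ (by positivity : 0 ≤ 1 / q)]
                  ring
        _ = ρ x ^ (1 / p) * ∫⁻ t,
              ((fun t => (ρ t * E x t) ^ (1 / q)) * fun t => E x t ^ (1 / p) * g t) t ∂μ := by
            refine lintegral_const_mul _ ?_
            have := hEx x
            exact ((hρ.mul this).pow_const _).mul ((this.pow_const _).mul hg)
        _ ≤ _ := by
            gcongr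
            have := hEx x
            refine (ENNReal.lintegral_mul_le_Lp_mul_Lq μ hpq.symm
              ((hρ.mul this).pow_const _).aemeasurable
              ((this.pow_const _).mul hg).aemeasurable).trans ?_
            gcongr with t
            · simp_rw [← ENNReal.rpow_mul, one_div_mul_cancel hq.ne', ENNReal.rpow_one]
              exact hC x
            · rw [Pi.mul_apply, ENNReal.mul_rpow_of_nonneg _ _ hp.le, ← ENNReal.rpow_mul,
                one_div_mul_cancel hp.ne', ENNReal.rpow_one]
    calc (∫⁻ t, K x t * g t ∂μ) ^ p
        ≤ (ρ x ^ (1 / p) * (C ^ (1 / q) * (∫⁻ t, E x t * g t ^ p ∂μ) ^ (1 / p))) ^ p := by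
          gcongr
      _ = _ := by
          rw [ENNReal.mul_rpow_of_nonneg _ _ hp.le, ENNReal.mul_rpow_of_nonneg _ _ hp.le,
            ← ENNReal.rpow_mul, ← ENNReal.rpow_mul, ← ENNReal.rpow_mul,
            one_div_mul_cancel hp.ne', ENNReal.rpow_one, ENNReal.rpow_one, one_div_mul_eq_div]
          ring
  have hgp : Measurable fun t => g t ^ p := hg.pow_const _
  have hmeas : Measurable (Function.uncurry fun x t => ρ x * (E x t * g t ^ p)) :=
    (hρ.comp measurable_fst).mul (hE.mul (hgp.comp measurable_snd))
  have hmeas' : Measurable fun x => ρ x * ∫⁻ t, E x t * g t ^ p ∂μ :=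
    hρ.mul (Measurable.lintegral_prod_right (hE.mul (hgp.comp measurable_snd)))
  calc ∫⁻ x, (∫⁻ t, K x t * g t ∂μ) ^ p ∂μ
      ≤ ∫⁻ x, C ^ (p / q) * (ρ x * ∫⁻ t, E x t * g t ^ p ∂μ) ∂μ := lintegral_mono hpoint
    _ = C ^ (p / q) * ∫⁻ x, ρ x * ∫⁻ t, E x t * g t ^ p ∂μ ∂μ := lintegral_const_mul _ hmeas'
    _ = C ^ (p / q) * ∫⁻ x, ∫⁻ t, ρ x * (E x t * g t ^ p) ∂μ ∂μ := by
        congr 1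
        refine lintegral_congr fun x => (lintegral_const_mul _ ((hEx x).mul hgp)).symm
    _ = C ^ (p / q) * ∫⁻ t, ∫⁻ x, ρ x * (E x t * g t ^ p) ∂μ ∂μ := by
        rw [lintegral_lintegral_swap hmeas.aemeasurable]
    _ ≤ C ^ (p / q) * ∫⁻ t, C * g t ^ p ∂μ := by
        gcongr with t
        calc ∫⁻ x, ρ x * (E x t * g t ^ p) ∂μ = ∫⁻ x, ρ x * E t x * g t ^ p ∂μ :=
              lintegral_congr fun x => by rw [hsymm x t, mul_assoc]
          _ = (∫⁻ x, ρ x * E t x ∂μ) * g t ^ p := lintegral_mul_const _ (hρ.mul (hEx t))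
          _ ≤ C * g t ^ p := by gcongr; exact hC t
    _ = _ := by rw [lintegral_const_mul _ hgp, mul_assoc]

/-- A kernel satisfying an `L^p` bound on nonnegative functions defines a bounded operator. -/
theorem exists_continuousLinearMap_of_lintegral_rpow_le {α : Type*} [MeasurableSpace α]
    {μ : Measure α} [SFinite μ] {p : ℝ≥0∞} [Fact (1 ≤ p)] (hp : p ≠ ⊤) {K : α → α → ℝ}
    {D : ℝ≥0∞} (hD : D ≠ ⊤) (hK : StronglyMeasurable (Function.uncurry K))
    (hb : ∀ g : α → ℝ≥0∞, Measurable g →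
      ∫⁻ x, (∫⁻ t, ‖K x t‖ₑ * g t ∂μ) ^ p.toReal ∂μ ≤ D * ∫⁻ t, g t ^ p.toReal ∂μ) :
    ∃ G : Lp ℝ p μ →L[ℝ] Lp ℝ p μ, ∀ f : Lp ℝ p μ,
      (G f : α → ℝ) =ᵐ[μ] fun x => ∫ t, K x t * (f : α → ℝ) t ∂μ := by
  have hp0 : p ≠ 0 := (zero_lt_one.trans_le (Fact.out : 1 ≤ p)).ne'
  have hpr : 0 < p.toReal := ENNReal.toReal_pos hp0 hp
  have hKe : Measurable (Function.uncurry fun x t => ‖K x t‖ₑ) := hK.enorm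
  have hKf : ∀ f : Lp ℝ p μ,
      StronglyMeasurable (Function.uncurry fun x t => K x t * (f : α → ℝ) t) := fun f =>
    hK.mul ((Lp.stronglyMeasurable f).comp_measurable measurable_snd)
  have hfin : ∀ f : Lp ℝ p μ, ∫⁻ t, ‖(f : α → ℝ) t‖ₑ ^ p.toReal ∂μ ≠ ⊤ := fun f =>
    (lintegral_rpow_enorm_lt_top_of_eLpNorm_lt_top hp0 hp (Lp.eLpNorm_lt_top f)).ne
  have hbf : ∀ f : Lp ℝ p μ, ∫⁻ x, (∫⁻ t, ‖K x t * (f : α → ℝ) t‖ₑ ∂μ) ^ p.toReal ∂μ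
      ≤ D * ∫⁻ t, ‖(f : α → ℝ) t‖ₑ ^ p.toReal ∂μ := by
    intro f
    simp_rw [enorm_mul]
    exact hb _ (Lp.stronglyMeasurable f).enorm
  have hint : ∀ f : Lp ℝ p μ, ∀ᵐ x ∂μ, Integrable (fun t => K x t * (f : α → ℝ) t) μ := by
    intro f
    have hm : Measurable fun x => (∫⁻ t, ‖K x t * (f : α → ℝ) t‖ₑ ∂μ) ^ p.toReal :=
      (Measurable.lintegral_prod_right (hKf f).enorm).pow_const _
    filter_upwards [ae_lt_top hm
      ((hbf f).trans_lt (ENNReal.mul_lt_top hD.lt_top (hfin f).lt_top)).ne] with x hx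
    refine ⟨((hKf f).comp_measurable measurable_prodMk_left).aestronglyMeasurable, ?_⟩
    exact (ENNReal.rpow_lt_top_iff_of_pos hpr).1 hx
  have hnorm : ∀ f : Lp ℝ p μ, eLpNorm (fun x => ∫ t, K x t * (f : α → ℝ) t ∂μ) p μ
      ≤ D ^ (1 / p.toReal) * eLpNorm f p μ := by
    intro f
    rw [eLpNorm_eq_lintegral_rpow_enorm_toReal hp0 hp,
      eLpNorm_eq_lintegral_rpow_enorm_toReal hp0 hp,
      ← ENNReal.mul_rpow_of_nonneg _ _ (by positivity)]
    gcongr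
    refine (lintegral_mono fun x => ?_).trans (hbf f)
    gcongr
    exact enorm_integral_le_lintegral_enorm _
  have hD' : D ^ (1 / p.toReal) ≠ ⊤ := ENNReal.rpow_ne_top_of_nonneg (by positivity) hD
  have hmem : ∀ f : Lp ℝ p μ, MemLp (fun x => ∫ t, K x t * (f : α → ℝ) t ∂μ) p μ := fun f =>
    ⟨(hKf f).integral_prod_right.aestronglyMeasurable,
      (hnorm f).trans_lt (ENNReal.mul_lt_top hD'.lt_top (Lp.eLpNorm_lt_top f))⟩
  let T : Lp ℝ p μ →ₗ[ℝ] Lp ℝ p μ :=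
    { toFun := fun f => (hmem f).toLp _
      map_add' := fun f g => by
        rw [← MemLp.toLp_add]
        refine (MemLp.toLp_eq_toLp_iff _ _).2 ?_
        filter_upwards [hint f, hint g] with x hf hg
        rw [Pi.add_apply, ← integral_add hf hg]
        refine integral_congr_ae ?_
        filter_upwards [Lp.coeFn_add f g] with t ht
        rw [ht, Pi.add_apply, mul_add]
      map_smul' := fun c f => by
        rw [RingHom.id_apply, ← MemLp.toLp_const_smul]
        refine (MemLp.toLp_eq_toLp_iff _ _).2 (Eventually.of_forall fun x => ?_)
        simp only [Pi.smul_apply]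
        rw [smul_eq_mul, ← integral_const_mul]
        refine integral_congr_ae ?_
        filter_upwards [Lp.coeFn_smul c f] with t ht
        rw [ht, Pi.smul_apply, smul_eq_mul, mul_left_comm] }
  refine ⟨T.mkContinuous (D ^ (1 / p.toReal)).toReal fun f => ?_, fun f => (hmem f).coeFn_toLp⟩
  change ‖(hmem f).toLp _‖ ≤ _
  rw [Lp.norm_toLp, Lp.norm_def, ← ENNReal.toReal_mul]
  exact ENNReal.toReal_mono (ENNReal.mul_ne_top hD' (Lp.eLpNorm_ne_top f)) (hnorm f)

/-- Absolute continuity is inherited along Lipschitz-type domination of increments. -/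
theorem AbsolutelyContinuousOnInterval.of_dist_le {f g : ℝ → ℝ} {a b K : ℝ}
    (hf : AbsolutelyContinuousOnInterval f a b)
    (h : ∀ x ∈ Set.uIcc a b, ∀ y ∈ Set.uIcc a b, dist (g x) (g y) ≤ K * dist (f x) (f y)) :
    AbsolutelyContinuousOnInterval g a b := by
  have h0 : Tendsto (fun E : ℕ × (ℕ → ℝ × ℝ) ↦
      K * ∑ i ∈ Finset.range E.1, dist (f (E.2 i).1) (f (E.2 i).2))
      (AbsolutelyContinuousOnInterval.totalLengthFilter ⊓
        𝓟 (AbsolutelyContinuousOnInterval.disjWithin a b)) (𝓝 0) := by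
    simpa using Tendsto.const_mul K hf
  refine squeeze_zero' (Eventually.of_forall fun _ => Finset.sum_nonneg fun _ _ => dist_nonneg)
    ?_ h0
  filter_upwards [mem_inf_of_right (mem_principal_self _)] with E hE
  rw [Finset.mul_sum]
  exact Finset.sum_le_sum fun i hi => h _ (hE.1 i hi).1 _ (hE.1 i hi).2

theorem AbsolutelyContinuousOnInterval.log {f : ℝ → ℝ} {a b : ℝ}
    (hf : AbsolutelyContinuousOnInterval f a b) (hpos : ∀ x, 0 < f x) :
    AbsolutelyContinuousOnInterval (fun x => Real.log (f x)) a b := by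
  obtain ⟨z, hz, hmin⟩ := isCompact_uIcc.exists_isMinOn Set.nonempty_uIcc hf.continuousOn
  have key : ∀ x ∈ Set.uIcc a b, ∀ y ∈ Set.uIcc a b,
      Real.log (f x) - Real.log (f y) ≤ (f z)⁻¹ * dist (f x) (f y) := by
    intro x _ y hy
    have hy' : f z ≤ f y := hmin hy
    rw [← Real.log_div (hpos x).ne' (hpos y).ne']
    calc Real.log (f x / f y) ≤ f x / f y - 1 :=
          Real.log_le_sub_one_of_pos (div_pos (hpos x) (hpos y))
      _ = (f y)⁻¹ * (f x - f y) := by have := (hpos y).ne'; field_simp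
      _ ≤ (f y)⁻¹ * dist (f x) (f y) := by
          have := (hpos y).le
          rw [Real.dist_eq]; gcongr; exact le_abs_self _
      _ ≤ _ := by have := hpos z; gcongr
  refine hf.of_dist_le (K := (f z)⁻¹) fun x hx y hy => ?_
  rw [Real.dist_eq]
  refine abs_sub_le_iff.2 ⟨key x hx y hy, ?_⟩
  rw [dist_comm]
  exact key y hy x hx

theorem absolutelyContinuousOnInterval_of_sub_eq_integral {f f' : ℝ → ℝ}
    (hint : ∀ a b : ℝ, IntervalIntegrable f' volume a b)
    (hf : ∀ a b : ℝ, f b - f a = ∫ t in a..b, f' t) (a b : ℝ) :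
    AbsolutelyContinuousOnInterval f a b := by
  refine ((hint a b).absolutelyContinuousOnInterval_intervalIntegral
    Set.left_mem_uIcc).of_dist_le (K := 1) fun x _ y _ => ?_
  rw [one_mul, Real.dist_eq, Real.dist_eq, hf, ← hf a x, ← hf a y, ← hf y x]
  simp

theorem ae_hasDerivAt_of_sub_eq_integral {f f' : ℝ → ℝ}
    (hint : ∀ a b : ℝ, IntervalIntegrable f' volume a b)
    (hf : ∀ a b : ℝ, f b - f a = ∫ t in a..b, f' t) (a b : ℝ) :
    ∀ᵐ x, x ∈ Set.uIcc a b → HasDerivAt f (f' x) x := by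
  filter_upwards [(hint a b).ae_hasDerivAt_integral] with x hx hxab
  have h := (hx hxab a Set.left_mem_uIcc).add_const (f a)
  have heq : f = fun y => (∫ t in a..y, f' t) + f a := by
    funext y; rw [← hf a y]; ring
  rwa [heq]

theorem PFSS.integral_eq_log_sub_log {r q u v u' v' : ℝ → ℝ} (h : PFSS r q u v u' v')
    (hr : ∀ x, 0 < r x) (a b : ℝ) :
    ∫ t in a..b, 1 / (r t * (u t * v t)) = Real.log (v b / u b) - Real.log (v a / u a) := by
  have hvac := (absolutelyContinuousOnInterval_of_sub_eq_integral h.v'_intble h.v_deriv a b).log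
    h.v_pos
  have huac := (absolutelyContinuousOnInterval_of_sub_eq_integral h.u'_intble h.u_deriv a b).log
    h.u_pos
  have hac := (hvac.fun_sub huac).integral_deriv_eq_sub
  have hlog : ∀ x, Real.log (v x / u x) = Real.log (v x) - Real.log (u x) := fun x =>
    Real.log_div (h.v_pos x).ne' (h.u_pos x).ne'
  rw [hlog, hlog, ← hac]
  refine intervalIntegral.integral_congr_ae ?_
  filter_upwards [ae_hasDerivAt_of_sub_eq_integral h.v'_intble h.v_deriv a b,
    ae_hasDerivAt_of_sub_eq_integral h.u'_intble h.u_deriv a b] with x hv hu hx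
  have hx' := Set.uIoc_subset_uIcc hx
  have hd := ((hv hx').log (h.v_pos x).ne').sub ((hu hx').log (h.u_pos x).ne')
  refine Eq.trans ?_ hd.deriv.symm
  have hv0 := (h.v_pos x).ne'
  have hu0 := (h.u_pos x).ne'
  have hr0 := (hr x).ne'
  have hw := h.wronskian x
  field_simp
  linarith

theorem PFSS.continuous_u_s3 {r q u v u' v' : ℝ → ℝ} (h : PFSS r q u v u' v') : Continuous u := by
  have : u = fun x => u 0 + ∫ t in (0 : ℝ)..x, u' t := by
    funext x; rw [← h.u_deriv]; ring
  rw [this]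
  exact continuous_const.add (intervalIntegral.continuous_primitive h.u'_intble 0)

theorem PFSS.continuous_v_s3 {r q u v u' v' : ℝ → ℝ} (h : PFSS r q u v u' v') : Continuous v := by
  have : v = fun x => v 0 + ∫ t in (0 : ℝ)..x, v' t := by
    funext x; rw [← h.v_deriv]; ring
  rw [this]
  exact continuous_const.add (intervalIntegral.continuous_primitive h.v'_intble 0)

theorem PFSS.antitone_u_s3 {r q u v u' v' : ℝ → ℝ} (h : PFSS r q u v u' v') : Antitone u := by
  intro a b hab
  have h1 : ∫ t in a..b, u' t ≤ 0 := by
    have := intervalIntegral.integral_nonneg (μ := volume) hab (f := fun t => -u' t)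
      fun t _ => neg_nonneg.2 (h.u'_nonpos t)
    rw [intervalIntegral.integral_neg] at this
    linarith
  linarith [h.u_deriv a b]

theorem PFSS.monotone_v_s3 {r q u v u' v' : ℝ → ℝ} (h : PFSS r q u v u' v') : Monotone v := by
  intro a b hab
  linarith [h.v_deriv a b, intervalIntegral.integral_nonneg (μ := volume) hab fun t _ => h.v'_nonneg t]

theorem PFSS.strictMono_log_div {r q u v u' v' : ℝ → ℝ} (h : PFSS r q u v u' v')
    (hr : ∀ x, 0 < r x) (hri : LocallyIntegrable (fun t => 1 / r t) volume) :
    StrictMono fun x => Real.log (v x / u x) := by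
  intro a b hab
  have hint : IntervalIntegrable (fun t => 1 / (r t * (u t * v t))) volume a b := by
    have h1 : IntervalIntegrable (fun t => 1 / r t) volume a b :=
      (hri.integrableOn_isCompact isCompact_uIcc).intervalIntegrable
    have h2 : Continuous fun t => (u t * v t)⁻¹ := (h.continuous_u_s3.mul h.continuous_v_s3).inv₀
      fun t => (mul_pos (h.u_pos t) (h.v_pos t)).ne'
    refine (h1.mul_continuousOn h2.continuousOn).congr fun t _ => ?_
    simp [mul_comm]
  have hpos := intervalIntegral.intervalIntegral_pos_of_pos hint
    (fun t => one_div_pos.2 (mul_pos (hr t) (mul_pos (h.u_pos t) (h.v_pos t)))) hab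
  rw [h.integral_eq_log_sub_log hr] at hpos
  exact sub_pos.1 hpos

theorem PFSS.surjective_log_div {r q u v u' v' : ℝ → ℝ} (h : PFSS r q u v u' v') :
    Function.Surjective fun x => Real.log (v x / u x) := by
  have hpos : ∀ x, 0 < v x / u x := fun x => div_pos (h.v_pos x) (h.u_pos x)
  have hcont : Continuous fun x => Real.log (v x / u x) :=
    (h.continuous_v_s3.div h.continuous_u_s3 fun x => (h.u_pos x).ne').log fun x => (hpos x).ne'
  refine hcont.surjective ?_ ?_
  · have h1 : Tendsto (fun x => u x / v x) atTop (𝓝[>] 0) :=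
      tendsto_nhdsWithin_iff.2 ⟨h.ratio_top,
        Eventually.of_forall fun x => div_pos (h.u_pos x) (h.v_pos x)⟩
    refine (tendsto_neg_atBot_atTop.comp (Real.tendsto_log_nhdsGT_zero.comp h1)).congr fun x => ?_
    simp only [Function.comp_apply]
    rw [← Real.log_inv, inv_div]
  · exact Real.tendsto_log_nhdsGT_zero.comp (tendsto_nhdsWithin_iff.2 ⟨h.ratio_bot,
        Eventually.of_forall hpos⟩)

theorem greenKernel_eq_max_min (u v : ℝ → ℝ) (x t : ℝ) :
    greenKernel u v x t = u (max x t) * v (min x t) := by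
  unfold greenKernel
  split_ifs with h
  · rw [max_eq_left h, min_eq_right h]
  · rw [max_eq_right (le_of_not_ge h), min_eq_left (le_of_not_ge h)]

theorem continuous_uncurry_greenKernel {u v : ℝ → ℝ} (hu : Continuous u) (hv : Continuous v) :
    Continuous (Function.uncurry (greenKernel u v)) := by
  have : Function.uncurry (greenKernel u v) = fun z : ℝ × ℝ => u (max z.1 z.2) * v (min z.1 z.2) :=
    funext fun z => greenKernel_eq_max_min u v z.1 z.2
  rw [this]
  fun_prop

/-- The increment of `log (v / u)` measures the ratio of the two off-diagonal products. -/
theorem mul_eq_exp_mul_of_log_div {u v : ℝ → ℝ} (hu : ∀ x, 0 < u x) (hv : ∀ x, 0 < v x) (a b : ℝ) :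
    u a * v b = Real.exp (Real.log (v b / u b) - Real.log (v a / u a)) * (u b * v a) := by
  rw [Real.exp_sub, Real.exp_log (div_pos (hv b) (hu b)), Real.exp_log (div_pos (hv a) (hu a))]
  have := (hu a).ne'
  have := (hu b).ne'
  have := (hv a).ne'
  field_simp

theorem greenKernel_le {u v : ℝ → ℝ} (hu : ∀ x, 0 < u x) (hv : ∀ x, 0 < v x) (hua : Antitone u)
    (hvm : Monotone v) {a b ε : ℝ} (hab : a + b = 1) (ha : ε ≤ a) (hb : ε ≤ b) (x t : ℝ) :
    greenKernel u v x t ≤ (u x * v x) ^ a * ((u t * v t) ^ b *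
      Real.exp (-ε * |Real.log (v x / u x) - Real.log (v t / u t)|)) := by
  have hlog : ∀ y, Real.log (v y / u y) = Real.log (v y) - Real.log (u y) := fun y =>
    Real.log_div (hv y).ne' (hu y).ne'
  have hlogm : ∀ y, Real.log (u y * v y) = Real.log (u y) + Real.log (v y) := fun y =>
    Real.log_mul (hu y).ne' (hv y).ne'
  have hmul : ∀ y z, u y * v z = Real.exp (Real.log (u y) + Real.log (v z)) := fun y z => by
    rw [Real.exp_add, Real.exp_log (hu y), Real.exp_log (hv z)]
  have hb' : b = 1 - a := by linarith
  rw [Real.rpow_def_of_pos (mul_pos (hu x) (hv x)), Real.rpow_def_of_pos (mul_pos (hu t) (hv t)),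
    ← Real.exp_add, ← Real.exp_add, hlog, hlog, hlogm, hlogm, greenKernel]
  split_ifs with h
  · have h1 := Real.log_le_log (hu x) (hua h)
    have h2 := Real.log_le_log (hv t) (hvm h)
    rw [abs_of_nonneg (by linarith), hmul, Real.exp_le_exp]
    subst hb'
    nlinarith [mul_nonneg (sub_nonneg.2 ha) (sub_nonneg.2 h2),
      mul_nonneg (sub_nonneg.2 hb) (sub_nonneg.2 h1)]
  · have h' := le_of_not_ge h
    have h1 := Real.log_le_log (hu t) (hua h')
    have h2 := Real.log_le_log (hv x) (hvm h')
    rw [abs_of_nonpos (by linarith), hmul, Real.exp_le_exp]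
    subst hb'
    nlinarith [mul_nonneg (sub_nonneg.2 hb) (sub_nonneg.2 h2),
      mul_nonneg (sub_nonneg.2 ha) (sub_nonneg.2 h1)]

theorem summable_exp_neg_mul_abs_int {ε : ℝ} (hε : 0 < ε) :
    Summable fun k : ℤ => Real.exp (-ε * |(k : ℝ)|) := by
  have h : Summable fun n : ℕ => Real.exp (-ε * |((n : ℤ) : ℝ)|) := by
    refine (summable_geometric_of_lt_one (Real.exp_pos (-ε)).le
      (Real.exp_lt_one_iff.2 (neg_lt_zero.2 hε))).congr fun n => ?_
    rw [← Real.exp_nat_mul, Int.cast_natCast, Nat.abs_cast, mul_comm]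
  exact Summable.of_nat_of_neg h (by simpa using h)

/-- If every level block `{a ≤ w ≤ a + 1}` has `m`-mass at most `M`, then integrals of
`exp (-ε |w x - w t|)` against `m` are bounded uniformly in `x`. -/
theorem lintegral_mul_exp_neg_abs_sub_le {w : ℝ → ℝ} (hw : StrictMono w)
    (hws : Function.Surjective w) {m : ℝ → ℝ≥0∞} {M : ℝ≥0∞}
    (hM : ∀ A B, w B - w A = 1 → ∫⁻ t in Set.Icc A B, m t ≤ M) (hm : Measurable m)
    {ε : ℝ} (hε : 0 < ε) (x : ℝ) :
    ∫⁻ t, m t * ENNReal.ofReal (Real.exp (-ε * |w x - w t|)) ≤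
      (∑' k : ℤ, ENNReal.ofReal (Real.exp ε * Real.exp (-ε * |(k : ℝ)|))) * M := by
  choose A hA using fun k : ℤ => hws (w x + k)
  have hcover : ⋃ k : ℤ, Set.Icc (A k) (A (k + 1)) = Set.univ := by
    refine Set.eq_univ_of_forall fun t => Set.mem_iUnion.2 ⟨⌊w t - w x⌋, ?_, ?_⟩
    · rw [← hw.le_iff_le, hA]
      linarith [Int.floor_le (w t - w x)]
    · rw [← hw.le_iff_le, hA]
      push_cast
      linarith [Int.lt_floor_add_one (w t - w x)]
  rw [← setLIntegral_univ, ← hcover, ← ENNReal.tsum_mul_right]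
  refine (lintegral_iUnion_le _ _).trans (ENNReal.tsum_le_tsum fun k => ?_)
  calc ∫⁻ t in Set.Icc (A k) (A (k + 1)), m t * ENNReal.ofReal (Real.exp (-ε * |w x - w t|))
      ≤ ∫⁻ t in Set.Icc (A k) (A (k + 1)),
          ENNReal.ofReal (Real.exp ε * Real.exp (-ε * |(k : ℝ)|)) * m t := by
        refine setLIntegral_mono (hm.const_mul _) fun t ht => ?_
        rw [mul_comm, ← Real.exp_add]
        gcongr
        have h1 : w x + k ≤ w t := by rw [← hA]; exact hw.monotone ht.1
        have h2 : w t ≤ w x + (k + 1) := by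
          have := hw.monotone ht.2
          rw [hA] at this
          push_cast at this
          exact this
        have h3 : |(k : ℝ)| ≤ |w x - w t| + 1 := by
          have h4 : |w t - w x - k| ≤ 1 := abs_le.2 ⟨by linarith, by linarith⟩
          have h5 := abs_sub_abs_le_abs_sub (k : ℝ) (w t - w x)
          rw [abs_sub_comm (k : ℝ)] at h5
          rw [abs_sub_comm (w x)]
          linarith
        nlinarith
    _ = ENNReal.ofReal (Real.exp ε * Real.exp (-ε * |(k : ℝ)|)) *
          ∫⁻ t in Set.Icc (A k) (A (k + 1)), m t := lintegral_const_mul _ hm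
    _ ≤ _ := by
        gcongr
        refine hM _ _ ?_
        rw [hA, hA]; push_cast; ring

/-- Any block on which `log (v / u)` increases by `1` has bounded `u * v`-mass when
`u * v * s` is bounded. -/
theorem PFSS.lintegral_block_le {r q u v u' v' s : ℝ → ℝ} (h : PFSS r q u v u' v')
    (hr : ∀ x, 0 < r x) (hri : LocallyIntegrable (fun t => 1 / r t) volume)
    (hs : IsS r (fun x => u x * v x) s) {S : ℝ} (hS : ∀ x, u x * v x * s x ≤ S) {A B : ℝ}
    (hAB : Real.log (v B / u B) - Real.log (v A / u A) = 1) :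
    ∫⁻ t in Set.Icc A B, ENNReal.ofReal (u t * v t) ≤
      ENNReal.ofReal (2 * Real.exp 1 * S) := by
  have hw := h.strictMono_log_div hr hri
  have hlt : A < B := hw.lt_iff_lt.1 (show Real.log (v A / u A) < Real.log (v B / u B) by linarith)
  set x := (A + B) / 2 with hx
  have hsx : s x = (B - A) / 2 := by
    have h1 := (hs x).2
    rw [h.integral_eq_log_sub_log hr] at h1
    rcases lt_trichotomy (s x) ((B - A) / 2) with hl | he | hg
    · have h2 := hw (show x + s x < B by linarith)
      have h3 := hw (show A < x - s x by linarith)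
      simp only at h2 h3
      linarith
    · exact he
    · have h2 := hw (show B < x + s x by linarith)
      have h3 := hw (show x - s x < A by linarith)
      simp only at h2 h3
      linarith
  have hAx : A ≤ x := by linarith
  have hxB : x ≤ B := by linarith
  have hpt : ∀ t ∈ Set.Icc A B, u t * v t ≤ Real.exp 1 * (u x * v x) := by
    intro t ht
    calc u t * v t ≤ u A * v B :=
          mul_le_mul (h.antitone_u_s3 ht.1) (h.monotone_v_s3 ht.2) (h.v_pos t).le (h.u_pos A).le
      _ = Real.exp 1 * (u B * v A) := by rw [mul_eq_exp_mul_of_log_div h.u_pos h.v_pos, hAB]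
      _ ≤ Real.exp 1 * (u x * v x) := by
          refine mul_le_mul_of_nonneg_left ?_ (Real.exp_pos _).le
          exact mul_le_mul (h.antitone_u_s3 hxB) (h.monotone_v_s3 hAx)
            (h.v_pos A).le (h.u_pos x).le
  calc ∫⁻ t in Set.Icc A B, ENNReal.ofReal (u t * v t)
      ≤ ∫⁻ _ in Set.Icc A B, ENNReal.ofReal (Real.exp 1 * (u x * v x)) :=
        setLIntegral_mono measurable_const fun t ht => ENNReal.ofReal_le_ofReal (hpt t ht)
    _ = ENNReal.ofReal (Real.exp 1 * (u x * v x) * (B - A)) := by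
        have := h.u_pos x
        have := h.v_pos x
        rw [setLIntegral_const, Real.volume_Icc, ← ENNReal.ofReal_mul (by positivity)]
    _ ≤ _ := by
        refine ENNReal.ofReal_le_ofReal ?_
        have h1 := hS x
        rw [hsx] at h1
        nlinarith [Real.exp_pos 1]

theorem PFSS.exists_isGreenOp {r q u v u' v' s : ℝ → ℝ} (h : PFSS r q u v u' v')
    (hr : ∀ x, 0 < r x) (hri : LocallyIntegrable (fun t => 1 / r t) volume)
    (hs : IsS r (fun x => u x * v x) s) {S : ℝ} (hS : ∀ x, u x * v x * s x ≤ S)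
    {p : ℝ≥0∞} (hp1 : 1 < p) (hp2 : p ≠ ⊤) [Fact (1 ≤ p)] :
    ∃ G : LpR p →L[ℝ] LpR p, IsGreenOp u v p G := by
  have hP : 1 < p.toReal := by
    rw [← ENNReal.toReal_one]
    exact (ENNReal.toReal_lt_toReal ENNReal.one_ne_top hp2).2 hp1
  have hpq := Real.HolderConjugate.conjExponent hP
  set P := p.toReal
  set Q := P.conjExponent
  have hsum : 1 / P + 1 / Q = 1 := by simpa using hpq.inv_add_inv_eq_one
  have hpos : ∀ x, 0 < u x * v x := fun x => mul_pos (h.u_pos x) (h.v_pos x)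
  have hPpos := hpq.pos
  have hQpos := hpq.symm.pos
  set ε := min (1 / P) (1 / Q)
  have hε : 0 < ε := lt_min (by positivity) (by positivity)
  have hρ : Measurable fun x => ENNReal.ofReal (u x * v x) :=
    (h.continuous_u_s3.mul h.continuous_v_s3).measurable.ennreal_ofReal
  have hwm : Measurable fun x => Real.log (v x / u x) :=
    (h.strictMono_log_div hr hri).monotone.measurable
  have hKc := continuous_uncurry_greenKernel h.continuous_u_s3 h.continuous_v_s3
  have hbound := lintegral_mul_exp_neg_abs_sub_le (h.strictMono_log_div hr hri)
    h.surjective_log_div (fun A B => h.lintegral_block_le hr hri hs hS) hρ hε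
  set C := (∑' k : ℤ, ENNReal.ofReal (Real.exp ε * Real.exp (-ε * |(k : ℝ)|))) *
    ENNReal.ofReal (2 * Real.exp 1 * S)
  have hC : C ≠ ⊤ :=
    ENNReal.mul_ne_top ((summable_exp_neg_mul_abs_int hε).mul_left _).tsum_ofReal_ne_top
      ENNReal.ofReal_ne_top
  refine exists_continuousLinearMap_of_lintegral_rpow_le hp2 (D := C ^ (P / Q) * C)
    (ENNReal.mul_ne_top (ENNReal.rpow_ne_top_of_nonneg (by positivity) hC) hC)
    hKc.stronglyMeasurable fun g hg => ?_
  refine lintegral_rpow_lintegral_mul_le hpq (ρ := fun x => ENNReal.ofReal (u x * v x))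
    (E := fun x t => ENNReal.ofReal
      (Real.exp (-ε * |Real.log (v x / u x) - Real.log (v t / u t)|))) ?_ hρ hg
    (fun x t => by rw [abs_sub_comm]) (fun x t => ?_) hbound
  · have h1 : Measurable fun z : ℝ × ℝ => Real.log (v z.1 / u z.1) := hwm.comp measurable_fst
    have h2 : Measurable fun z : ℝ × ℝ => Real.log (v z.2 / u z.2) := hwm.comp measurable_snd
    exact (((h1.sub h2).abs.const_mul (-ε)).exp).ennreal_ofReal
  · have hK0 : 0 ≤ greenKernel u v x t := by
      rw [greenKernel_eq_max_min]
      exact mul_nonneg (h.u_pos _).le (h.v_pos _).le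
    rw [Real.enorm_of_nonneg hK0, ENNReal.ofReal_rpow_of_pos (hpos x),
      ENNReal.ofReal_rpow_of_pos (hpos t), ← ENNReal.ofReal_mul (by have := hpos t; positivity),
      ← ENNReal.ofReal_mul (by have := hpos x; positivity)]
    exact ENNReal.ofReal_le_ofReal (greenKernel_le h.u_pos h.v_pos h.antitone_u_s3 h.monotone_v_s3 hsum
      (min_le_left _ _) (min_le_right _ _) x t)

theorem PFSS.mul_le_of_isGreenOp {r q u v u' v' s : ℝ → ℝ} (h : PFSS r q u v u' v')
    (hr : ∀ x, 0 < r x) (hs : IsS r (fun x => u x * v x) s)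
    {p : ℝ≥0∞} (hp2 : p ≠ ⊤) [Fact (1 ≤ p)] {G : LpR p →L[ℝ] LpR p} (hG : IsGreenOp u v p G)
    (x : ℝ) : u x * v x * s x ≤ Real.exp 1 / 2 * ‖G‖ := by
  have hp0 : p ≠ 0 := (zero_lt_one.trans_le (Fact.out : 1 ≤ p)).ne'
  obtain ⟨hsx, hsint⟩ := hs x
  rw [h.integral_eq_log_sub_log hr] at hsint
  set I := Set.Icc (x - s x) (x + s x)
  have hI : MeasurableSet I := measurableSet_Icc
  have hIfin : volume I ≠ ⊤ := measure_Icc_lt_top.ne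
  have hIvol : volume.real I = 2 * s x := by
    rw [Real.volume_real_Icc_of_le (by linarith)]; ring
  set f : LpR p := indicatorConstLp p hI hIfin (1 : ℝ)
  have hf : (f : ℝ → ℝ) =ᵐ[volume] I.indicator fun _ => 1 := indicatorConstLp_coeFn
  set c := Real.exp (-1) * (u x * v x)
  have hc : 0 < c := mul_pos (Real.exp_pos _) (mul_pos (h.u_pos x) (h.v_pos x))
  have hker : ∀ y ∈ I, ∀ t ∈ I, c ≤ greenKernel u v y t := by
    intro y hy t ht
    have key := mul_eq_exp_mul_of_log_div h.u_pos h.v_pos (x + s x) (x - s x)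
    rw [← neg_sub (Real.log (v (x + s x) / u (x + s x))), hsint] at key
    calc c ≤ Real.exp (-1) * (u (x - s x) * v (x + s x)) := by
          refine mul_le_mul_of_nonneg_left ?_ (Real.exp_pos _).le
          exact mul_le_mul (h.antitone_u_s3 (by linarith)) (h.monotone_v_s3 (by linarith))
            (h.v_pos x).le (h.u_pos _).le
      _ = u (x + s x) * v (x - s x) := key.symm
      _ ≤ greenKernel u v y t := by
          rw [greenKernel_eq_max_min]
          exact mul_le_mul (h.antitone_u_s3 (max_le hy.2 ht.2)) (h.monotone_v_s3 (le_min hy.1 ht.1))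
            (h.v_pos _).le (h.u_pos _).le
  have hlow : ∀ y ∈ I, c * (2 * s x) ≤ ∫ t, greenKernel u v y t * (f : ℝ → ℝ) t := by
    intro y hy
    have h1 : ∫ t, greenKernel u v y t * (f : ℝ → ℝ) t = ∫ t in I, greenKernel u v y t := by
      rw [← integral_indicator hI]
      refine integral_congr_ae ?_
      filter_upwards [hf] with t ht
      rw [ht]
      by_cases htI : t ∈ I <;> simp [htI]
    have hcont : Continuous (greenKernel u v y) :=
      (continuous_uncurry_greenKernel h.continuous_u_s3 h.continuous_v_s3).comp
        (Continuous.prodMk_right y)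
    calc c * (2 * s x) = ∫ _ in I, c := by
          rw [setIntegral_const, hIvol, smul_eq_mul, mul_comm]
      _ ≤ ∫ t in I, greenKernel u v y t :=
          setIntegral_mono_on (integrableOn_const hIfin) (hcont.continuousOn.integrableOn_Icc) hI
            (hker y hy)
      _ = _ := h1.symm
  have hnorm : ‖(c * (2 * s x)) • f‖ ≤ ‖G f‖ := by
    refine Lp.norm_le_norm_of_ae_le ?_
    filter_upwards [hf, hG f, Lp.coeFn_smul (c * (2 * s x)) f] with y hy hGy hsy
    rw [hsy, hGy, Pi.smul_apply, hy]
    by_cases hyI : y ∈ I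
    · simp only [hyI, Set.indicator_of_mem, smul_eq_mul, mul_one]
      rw [Real.norm_of_nonneg (by positivity)]
      exact (hlow y hyI).trans (le_abs_self _)
    · simp [hyI]
  have hfpos : 0 < ‖f‖ := by
    rw [norm_indicatorConstLp hp0 hp2, hIvol, norm_one, one_mul]
    positivity
  rw [norm_smul, Real.norm_of_nonneg (by positivity)] at hnorm
  have h2 : c * (2 * s x) ≤ ‖G‖ := le_of_mul_le_mul_right (hnorm.trans (G.le_opNorm f)) hfpos
  have h3 : Real.exp 1 * Real.exp (-1) = 1 := by rw [← Real.exp_add]; simp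
  calc u x * v x * s x = Real.exp 1 * Real.exp (-1) * (u x * v x * s x) := by rw [h3, one_mul]
    _ = Real.exp 1 / 2 * (c * (2 * s x)) := by ring
    _ ≤ _ := by gcongr

/-- **Theorem 2.22.** Assume (1.2) and (2.1), let `u, v` be a principal FSS
with `ρ = u·v`, and let `p ∈ (1,∞)`.  The Green operator is bounded on
`L_p(ℝ)` iff `S = sup_x ρ(x) s(x) < ∞`. -/
theorem green_bounded_iff_S_finite
    (r q u v u' v' s : ℝ → ℝ) (p : ℝ≥0∞) (hp1 : 1 < p) (hp2 : p ≠ ⊤)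
    [Fact (1 ≤ p)]
    (h12 : Cond12 r q) (h21 : Cond21 q) (hfss : PFSS r q u v u' v')
    (hs : IsS r (fun x => u x * v x) s) :
    (∃ G : LpR p →L[ℝ] LpR p, IsGreenOp u v p G) ↔
      BddAbove (Set.range fun x => u x * v x * s x) := by
  obtain ⟨-, -, hr, -, hri, -⟩ := h12
  constructor
  · rintro ⟨G, hG⟩
    refine ⟨Real.exp 1 / 2 * ‖G‖, ?_⟩
    rintro _ ⟨x, rfl⟩
    exact hfss.mul_le_of_isGreenOp hr hs hp2 hG x
  · rintro ⟨S, hS⟩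
    exact hfss.exists_isGreenOp hr hri hs (fun x => hS ⟨x, rfl⟩) hp1 hp2
end
end
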